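/- For every positive integer h, every graph with average degree at least 256·h² contains a subdivision of the complete graph K_h as a subgraph. -/

import Mathlib

open SimpleGraph

/-- `G` contains a copy of `H` as a (not necessarily induced) subgraph. -/
def HasSubgraphCopy {V W : Type} (G : SimpleGraph V) (H : SimpleGraph W) : Prop :=
  ∃ f : H →g G, Function.Injective f

/-- `G` contains an induced copy of `H`. -/
def HasInducedCopy {V W : Type} (G : SimpleGraph V) (H : SimpleGraph W) : Prop :=
  ∃ s : Set V, Nonempty ((G.induce s) ≃g H)

/-- The graph obtained from `G` by subdividing the edge `ab` once (`none` is the new vertex). -/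
def edgeSubdiv {V : Type} (G : SimpleGraph V) (a b : V) : SimpleGraph (Option V) :=
  SimpleGraph.fromRel (fun x y =>
    (∃ x' y' : V, x = some x' ∧ y = some y' ∧ G.Adj x' y' ∧
      ¬((x' = a ∧ y' = b) ∨ (x' = b ∧ y' = a))) ∨
    (x = none ∧ (y = some a ∨ y = some b)))

/-- `IsSubdivision H S` : `S` is obtained from `H` by a finite sequence of single edge
subdivisions (edges of `H` get replaced by possibly longer paths). -/
inductive IsSubdivision : {V : Type} → SimpleGraph V → {W : Type} → SimpleGraph W → Prop
  | refl {V : Type} (G : SimpleGraph V) : IsSubdivision G G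
  | step {V W : Type} (G : SimpleGraph V) (H : SimpleGraph W) (a b : W) :
      IsSubdivision G H → H.Adj a b → IsSubdivision G (edgeSubdiv H a b)

/-- `G` contains an induced subdivision of `H`, i.e. some induced subgraph of `G` is
isomorphic to a subdivision of `H`. -/
def HasInducedSubdivision {V W : Type} (G : SimpleGraph V) (H : SimpleGraph W) : Prop :=
  ∃ (U : Type) (S : SimpleGraph U), IsSubdivision H S ∧ HasInducedCopy G S

/-- The average degree `2e(G)/|V(G)|` of a finite graph. -/
noncomputable def avgDeg {V : Type} (G : SimpleGraph V) [Fintype V] : ℝ :=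
  2 * G.edgeSet.ncard / Fintype.card V


section Aux
open scoped Classical
set_option linter.all false
variable {V : Type} [Fintype V] {C : Type}

/-- Outer neighbourhood of a vertex set. -/
noncomputable def nb (G : SimpleGraph V) (W : Finset V) : Finset V :=
  Finset.univ.filter (fun v => v ∉ W ∧ ∃ w ∈ W, G.Adj w v)

lemma mem_nb {G : SimpleGraph V} {W : Finset V} {v : V} :
    v ∈ nb G W ↔ v ∉ W ∧ ∃ w ∈ W, G.Adj w v := by simp [nb]

/-- Ordered pairs of adjacent vertices meeting `W`. -/
noncomputable def rhoSet (G : SimpleGraph V) (W : Finset V) : Finset (V × V) :=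
  Finset.univ.filter (fun p : V × V => G.Adj p.1 p.2 ∧ (p.1 ∈ W ∨ p.2 ∈ W))

lemma mem_rhoSet {G : SimpleGraph V} {W : Finset V} {x y : V} :
    (x, y) ∈ rhoSet G W ↔ G.Adj x y ∧ (x ∈ W ∨ y ∈ W) := by simp [rhoSet]

/-- Twice the number of edges meeting `W`. -/
noncomputable def rho (G : SimpleGraph V) (W : Finset V) : ℕ := (rhoSet G W).card

/-- Monochromatic part of `G` inside the region `R`. -/
def mono (G : SimpleGraph V) (R : Finset V) (f : V → C) : SimpleGraph V where
  Adj x y := G.Adj x y ∧ x ∈ R ∧ y ∈ R ∧ f x = f y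
  symm := ⟨fun _ _ h => ⟨h.1.symm, h.2.2.1, h.2.1, h.2.2.2.symm⟩⟩
  loopless := ⟨fun x h => G.loopless.irrefl x h.1⟩

lemma reach_mono_of {H K : SimpleGraph V} (h : ∀ x y, H.Adj x y → K.Reachable x y)
    {x y : V} (hr : H.Reachable x y) : K.Reachable x y := by
  obtain ⟨w⟩ := hr
  induction w with
  | nil => exact SimpleGraph.Reachable.refl _
  | cons hadj _ ih => exact (h _ _ hadj).trans ih

/-- Delete one edge. -/
def del (G : SimpleGraph V) (x y : V) : SimpleGraph V where
  Adj a b := G.Adj a b ∧ s(a, b) ≠ s(x, y)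
  symm := ⟨fun a b h => ⟨h.1.symm, by rw [Sym2.eq_swap]; exact h.2⟩⟩
  loopless := ⟨fun x h => G.loopless.irrefl x h.1⟩

lemma del_adj {G : SimpleGraph V} {x y a b : V} :
    (del G x y).Adj a b ↔ G.Adj a b ∧ ¬ (a = x ∧ b = y) ∧ ¬ (a = y ∧ b = x) := by
  simp [del, Sym2.eq_iff]

/-- Edges of `G` touching `D`. -/
def touch (G : SimpleGraph V) (D : Finset V) : SimpleGraph V where
  Adj a b := G.Adj a b ∧ (a ∈ D ∨ b ∈ D)
  symm := ⟨fun a b h => ⟨h.1.symm, h.2.symm⟩⟩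
  loopless := ⟨fun x h => G.loopless.irrefl x h.1⟩

lemma touch_adj {G : SimpleGraph V} {D : Finset V} {a b : V} :
    (touch G D).Adj a b ↔ G.Adj a b ∧ (a ∈ D ∨ b ∈ D) := Iff.rfl

lemma mono_adj {G : SimpleGraph V} {R : Finset V} {f : V → C} {a b : V} :
    (mono G R f).Adj a b ↔ G.Adj a b ∧ a ∈ R ∧ b ∈ R ∧ f a = f b := Iff.rfl

lemma rho_lt_of {G H : SimpleGraph V} (hle : ∀ a b, H.Adj a b → G.Adj a b) {U : Finset V}
    {x y : V} (hG : G.Adj x y) (hU : x ∈ U ∨ y ∈ U) (hH : ¬ H.Adj x y) : rho H U < rho G U := by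
  apply Finset.card_lt_card
  refine ⟨?_, ?_⟩
  · rintro ⟨a, b⟩ h
    rw [mem_rhoSet] at h ⊢
    exact ⟨hle _ _ h.1, h.2⟩
  · intro h
    have := h (mem_rhoSet.2 ⟨hG, hU⟩)
    exact hH (mem_rhoSet.1 this).1

/-- The conclusion of the theorem of Menger. -/
def Connector (H : SimpleGraph V) (A B : Finset V) (s : ℕ) : Prop :=
  ∃ T : Finset V, T ⊆ A ∧ T.card = s ∧ ∃ f b : V → V, ∀ a ∈ T,
    f a = a ∧ b a ∈ B ∧ f (b a) = a ∧ (mono H Finset.univ f).Reachable a (b a)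

lemma Connector.glue {G : SimpleGraph V} {A B S C D : Finset V} {x y : V} {s : ℕ}
    (hxy : G.Adj x y) (hx : x ∈ C) (hxS : x ∉ S) (hyC : y ∉ C) (hyS : y ∉ S)
    (hCS : Disjoint C S)
    (hS : S.card + 1 = s) (hD : ∀ v, v ∈ D ↔ v ∉ C ∧ v ∉ S)
    (hCnb : ∀ u ∈ C, ∀ v, (del G x y).Adj u v → v ∈ C ∨ v ∈ S)
    (h1 : Connector (touch (del G x y) C) A (insert x S) s)
    (h2 : Connector (touch (del G x y) D) (insert y S) B s) : Connector G A B s := by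
  obtain ⟨T1, hT1, hc1, f1, b1, h1⟩ := h1
  obtain ⟨T2, hT2, hc2, f2, b2, h2⟩ := h2
  have hT2' : T2 = insert y S :=
    Finset.eq_of_subset_of_card_le hT2 (by rw [Finset.card_insert_of_notMem hyS]; omega)
  have hsurj : ∀ z ∈ insert x S, ∃ a ∈ T1, b1 a = z := by
    intro z hz
    have := Finset.surjOn_of_injOn_of_card_le (s := T1) (t := insert x S) b1
      (fun a ha => (h1 a ha).2.1) (fun a ha a' ha' h => by
        rw [← (h1 a ha).2.2.1, ← (h1 a' ha').2.2.1]; exact congrArg f1 h)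
      (by rw [Finset.card_insert_of_notMem hxS]; omega)
    obtain ⟨a, ha, h⟩ := this hz
    exact ⟨a, ha, h⟩
  let sw : V → V := fun z => if z = y then x else z
  let sw' : V → V := fun z => if z = x then y else z
  let f : V → V := fun v => if v ∈ D then f1 (sw (f2 v)) else f1 v
  have hfD : ∀ v, v ∈ D ∨ v ∈ S → f v = f1 (sw (f2 v)) := by
    intro v hv
    by_cases hvD : v ∈ D
    · simp [f, hvD]
    · have hvS : v ∈ S := by tauto
      have h3 := (h2 v (by rw [hT2']; exact Finset.mem_insert_of_mem hvS)).1
      have : v ≠ y := by rintro rfl; exact hyS hvS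
      simp [f, hvD, h3, sw, this]
  have hfC : ∀ v, v ∉ D → f v = f1 v := by
    intro v hv; simp [f, hv]
  have hr1 : ∀ p q, (mono (touch (del G x y) C) Finset.univ f1).Adj p q →
      (mono G Finset.univ f).Adj p q := by
    rintro p q ⟨⟨hd, hpq⟩, -, -, hf⟩
    have hp : p ∉ D ∧ q ∉ D := by
      rw [hD, hD]
      rcases hpq with h | h
      · have := hCnb p h q hd; tauto
      · have := hCnb q h p hd.symm; tauto
    exact ⟨hd.1, by simp, by simp, by rw [hfC p hp.1, hfC q hp.2, hf]⟩
  have hr2 : ∀ p q, (mono (touch (del G x y) D) Finset.univ f2).Adj p q →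
      (mono G Finset.univ f).Adj p q := by
    rintro p q ⟨⟨hd, hpq⟩, -, -, hf⟩
    have hp : (p ∈ D ∨ p ∈ S) ∧ (q ∈ D ∨ q ∈ S) := by
      have e1 := hD p
      have e2 := hD q
      have e3 := fun h => hCnb p h q hd
      have e4 := fun h => hCnb q h p hd.symm
      tauto
    exact ⟨hd.1, by simp, by simp, by rw [hfD p hp.1, hfD q hp.2, hf]⟩
  have hyD : y ∈ D := (hD y).2 ⟨hyC, hyS⟩
  refine ⟨T1, hT1, hc1, f, fun a => b2 (sw' (b1 a)), fun a ha => ?_⟩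
  obtain ⟨g1, g2, g3, g4⟩ := h1 a ha
  have hz : sw' (b1 a) ∈ T2 := by
    rw [hT2']
    by_cases h : b1 a = x
    · simp [sw', h]
    · simp [sw', h]; rw [Finset.mem_insert] at g2; tauto
  obtain ⟨k1, k2, k3, k4⟩ := h2 _ hz
  have R1 : (mono G Finset.univ f).Reachable a (b1 a) :=
    reach_mono_of (fun p q h => (hr1 p q h).reachable) g4
  have R2 : (mono G Finset.univ f).Reachable (sw' (b1 a)) (b2 (sw' (b1 a))) :=
    reach_mono_of (fun p q h => (hr2 p q h).reachable) k4
  have hfb : f (b1 a) = a := by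
    rw [hfC, g3]
    rw [hD]
    rw [Finset.mem_insert] at g2
    rcases g2 with h | h
    · rw [h]; tauto
    · tauto
  have R3 : (mono G Finset.univ f).Reachable (b1 a) (sw' (b1 a)) := by
    by_cases h : b1 a = x
    · have e : sw' (b1 a) = y := by simp [sw', h]
      rw [e] at k1 ⊢
      apply SimpleGraph.Adj.reachable
      refine ⟨by rw [h]; exact hxy, by simp, by simp, ?_⟩
      rw [hfb, hfD y (Or.inl hyD), k1]
      simp only [sw, if_true]
      rw [← h, g3]
    · have e : sw' (b1 a) = b1 a := by simp [sw', h]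
      rw [e]
  have hall := (R1.trans R3).trans R2
  have hconst : ∀ p q, (mono G Finset.univ f).Reachable p q → f p = f q := by
    rintro p q ⟨w⟩
    induction w with
    | nil => rfl
    | cons h _ ih => exact h.2.2.2.trans ih
  have h5 := hconst _ _ (R3.trans R2)
  have h6 := hconst _ _ R1
  exact ⟨by rw [h6, hfb], k2, by rw [← h5, hfb], hall⟩

theorem menger (n : ℕ) : ∀ (G : SimpleGraph V) (A B : Finset V) (s : ℕ), rho G Finset.univ = n →
    (∀ C : Finset V, Disjoint C B → s ≤ ((A \ C) ∪ nb G C).card) → Connector G A B s := by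
  induction n using Nat.strong_induction_on with
  | _ n IH =>
  intro G A B s hn hs
  by_cases hG : ∃ x y, G.Adj x y
  swap
  · have hs := hs Bᶜ disjoint_compl_left
    have : (A \ Bᶜ) ∪ nb G Bᶜ = A ∩ B := by
      ext v
      simp only [Finset.mem_union, Finset.mem_sdiff, Finset.mem_compl, Finset.mem_inter, mem_nb]
      grind
    rw [this] at hs
    obtain ⟨T, hT, hc⟩ := Finset.exists_subset_card_eq hs
    refine ⟨T, hT.trans Finset.inter_subset_left, hc, id, id, fun a ha => ⟨rfl, ?_, rfl, by rfl⟩⟩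
    exact (Finset.mem_inter.1 (hT ha)).2
  obtain ⟨x, y, hxy⟩ := hG
  by_cases hdel : ∀ C : Finset V, Disjoint C B → s ≤ ((A \ C) ∪ nb (del G x y) C).card
  · have hlt : rho (del G x y) Finset.univ < n := by
      rw [← hn]
      exact rho_lt_of (fun a b (h : (del G x y).Adj a b) => h.1) hxy (by simp) (by simp [del_adj])
    obtain ⟨T, h1, h2, f, b, h3⟩ := IH _ hlt _ A B s rfl hdel
    refine ⟨T, h1, h2, f, b, fun a ha => ?_⟩
    obtain ⟨g1, g2, g3, g4⟩ := h3 a ha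
    exact ⟨g1, g2, g3, reach_mono_of (fun p q (h : (mono (del G x y) Finset.univ f).Adj p q) =>
      SimpleGraph.Adj.reachable (G := mono G Finset.univ f) ⟨h.1.1, h.2⟩) g4⟩
  push Not at hdel
  obtain ⟨C, hCB, hC⟩ := hdel
  have hsC := hs C hCB
  have : ∃ v w, v ∈ nb G C ∧ w ∈ C ∧ G.Adj w v ∧ v ∉ A \ C ∪ nb (del G x y) C ∧
      s(w, v) = s(x, y) := by
    by_contra hcon
    push Not at hcon
    have hsub : A \ C ∪ nb G C ⊆ A \ C ∪ nb (del G x y) C := by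
      intro v hv
      by_contra hv'
      have hv2 : v ∈ nb G C := by simp at hv hv'; tauto
      obtain ⟨hvC, w, hw, hwv⟩ := mem_nb.1 hv2
      have := hcon v w hv2 hw hwv hv'
      apply hv'
      exact Finset.mem_union_right _ (mem_nb.2 ⟨hvC, w, hw, hwv, this⟩)
    have := Finset.card_le_card hsub
    omega
  obtain ⟨v, w, hv, hw, hwv, hvS, hs2⟩ := this
  have hdeq : del G x y = del G w v := by
    ext a b; simp only [del]; rw [hs2]
  rw [hdeq] at hvS hC
  clear hdeq hs2 hxy x y
  set S := A \ C ∪ nb (del G w v) C with hSdef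
  have hvC : v ∉ C := (mem_nb.1 hv).1
  have hCS : Disjoint C S := by
    rw [Finset.disjoint_left]
    intro a ha h
    simp only [hSdef, Finset.mem_union, Finset.mem_sdiff, mem_nb] at h
    tauto
  have hwS : w ∉ S := Finset.disjoint_left.1 hCS hw
  have hCnb : ∀ u ∈ C, ∀ z, (del G w v).Adj u z → z ∈ C ∨ z ∈ S := by
    intro u hu z huz
    by_cases hz : z ∈ C
    · exact Or.inl hz
    · exact Or.inr (Finset.mem_union_right _ (mem_nb.2 ⟨hz, u, hu, huz⟩))
  have hAS : ∀ a ∈ A, a ∉ C → a ∈ S := fun a ha h =>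
    Finset.mem_union_left _ (Finset.mem_sdiff.2 ⟨ha, h⟩)
  have hGC : ∀ u ∈ C, ∀ z, G.Adj u z → z ∉ C → z ∈ insert v S := by
    intro u hu z huz hz
    by_cases h : (del G w v).Adj u z
    · exact Finset.mem_insert_of_mem ((hCnb u hu z h).resolve_left hz)
    · rw [del_adj] at h
      rw [Finset.mem_insert]
      grind
  have hcard : S.card + 1 = s := by
    have : (A \ C ∪ nb G C) ⊆ insert v S := by
      intro z hz
      rw [Finset.mem_union] at hz
      rcases hz with h | h
      · exact Finset.mem_insert_of_mem (Finset.mem_union_left _ h)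
      · obtain ⟨h1, u, hu, h2⟩ := mem_nb.1 h
        exact hGC u hu z h2 h1
    have := Finset.card_le_card this
    rw [Finset.card_insert_of_notMem hvS] at this
    omega
  have hlt : ∀ D, rho (touch (del G w v) D) Finset.univ < n := by
    intro D
    rw [← hn]
    exact rho_lt_of (fun a b (h : (touch (del G w v) D).Adj a b) => h.1.1) hwv (by simp) (by simp [touch_adj, del_adj])
  have hB : ∀ z ∈ C, z ∉ B := fun z hz => Finset.disjoint_left.1 hCB hz
  refine Connector.glue (D := (C ∪ S)ᶜ) hwv hw hwS hvC hvS hCS hcard (by simp) hCnb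
    (IH _ (hlt _) _ _ _ _ rfl ?_) (IH _ (hlt _) _ _ _ _ rfl ?_)
  · intro C' hC'
    have hC'S : ∀ z ∈ C', z ≠ w ∧ z ∉ S := by
      intro z hz
      have := Finset.disjoint_left.1 hC' hz
      simpa using this
    refine (hs (C' ∩ C) ?_).trans (Finset.card_le_card ?_)
    · rw [Finset.disjoint_left]; intro z hz; exact hB z (Finset.mem_inter.1 hz).2
    · intro z hz
      simp only [Finset.mem_union, Finset.mem_sdiff, Finset.mem_inter, mem_nb, touch_adj,
        del_adj] at hz ⊢
      rcases hz with ⟨hzA, hz⟩ | ⟨hz, u, ⟨hu', hu⟩, huz⟩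
      · left
        refine ⟨hzA, fun h => ?_⟩
        exact (hC'S z h).2 (hAS z hzA (fun h' => hz ⟨h, h'⟩))
      · right
        have e1 : u ≠ w := (hC'S u hu').1
        have e2 : u ≠ v := by rintro rfl; exact hvC hu
        have e3 : (del G w v).Adj u z := by rw [del_adj]; tauto
        refine ⟨fun h => ?_, u, hu', ⟨huz, by tauto, by tauto⟩, Or.inl hu⟩
        rcases hCnb u hu z e3 with h' | h'
        · exact hz ⟨h, h'⟩
        · exact (hC'S z h).2 h'
  · intro C' hC'
    refine (hs (C ∪ C') ?_).trans (Finset.card_le_card ?_)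
    · exact Finset.disjoint_union_left.2 ⟨hCB, hC'⟩
    · intro z hz
      rw [Finset.mem_union, Finset.mem_sdiff, mem_nb] at hz
      simp only [Finset.mem_union, not_or] at hz
      rw [Finset.mem_union, Finset.mem_sdiff, mem_nb]
      rcases hz with ⟨hzA, hz1, hz2⟩ | ⟨⟨hz1, hz2⟩, u, hu, huz⟩
      · left
        exact ⟨Finset.mem_insert_of_mem (hAS z hzA hz1), hz2⟩
      · by_cases hzS : z ∈ S
        · exact Or.inl ⟨Finset.mem_insert_of_mem hzS, hz2⟩
        by_cases huC : u ∈ C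
        · exact Or.inl ⟨hGC u huC z huz hz1, hz2⟩
        · right
          refine ⟨hz2, u, by tauto, ?_⟩
          rw [touch_adj, del_adj]
          refine ⟨⟨huz, ?_, ?_⟩, Or.inr ?_⟩
          · rintro ⟨rfl, rfl⟩; exact huC hw
          · rintro ⟨rfl, rfl⟩; exact hz1 hw
          · simp [hz1, hzS]

/-- Every colouring of `X` extends to `U ∪ X` with colour classes connecting `X`. -/
def Linked (C : Type) (G : SimpleGraph V) (U X : Finset V) : Prop :=
  ∀ c : V → C, ∃ f : V → C, (∀ x ∈ X, f x = c x) ∧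
    ∀ x ∈ X, ∀ y ∈ X, c x = c y → (mono G (U ∪ X) f).Reachable x y

structure Core (C : Type) (G : SimpleGraph V) (D Y : Finset V) (m : ℕ) : Prop where
  sub : Y ⊆ D
  ent : ∀ u, u ∉ D → ∀ d ∈ D, G.Adj u d → d ∈ Y
  link : ∀ T ⊆ Y, T.card ≤ m → ∀ c : V → C, ∃ f : V → C, (∀ x ∈ T, f x = c x) ∧
    ∀ x ∈ T, ∀ y ∈ T, c x = c y → (mono G D f).Reachable x y

lemma first_hit {H : SimpleGraph V} {B : Finset V} {a b : V} (h : H.Reachable a b) (hb : b ∈ B) :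
    ∃ b' ∈ B, Relation.ReflTransGen (fun u v => H.Adj u v ∧ u ∉ B) a b' := by
  obtain ⟨w⟩ := h
  induction w with
  | nil => exact ⟨_, hb, Relation.ReflTransGen.refl⟩
  | @cons u v _ hadj _ ih =>
    by_cases hu : u ∈ B
    · exact ⟨u, hu, Relation.ReflTransGen.refl⟩
    · obtain ⟨b', hb', h⟩ := ih hb
      exact ⟨b', hb', Relation.ReflTransGen.head ⟨hadj, hu⟩ h⟩

lemma mono_const {G : SimpleGraph V} {R : Finset V} {f : V → C} {p q : V}
    (h : (mono G R f).Reachable p q) : f p = f q := by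
  obtain ⟨w⟩ := h
  induction w with
  | nil => rfl
  | cons h _ ih => exact h.2.2.2.trans ih

lemma core_step {G : SimpleGraph V} {U X D Y : Finset V} {m : ℕ}
    (hN : nb G U ⊆ X) (hUX : Disjoint U X) (hD : D ⊆ U ∪ X) (hXD : ∀ v ∈ X, v ∈ D → v ∈ Y)
    (hcore : Core C G D Y m) (hm : X.card ≤ m) :
    Linked C G U X ∨ ∃ W S : Finset V, W ⊆ U ∧ S ⊆ U ∪ X ∧ Disjoint W S ∧ nb G W ⊆ S ∧
      D ⊆ W ∪ S ∧ (∀ v ∈ S, v ∈ D → v ∈ Y) ∧ S.card < X.card := by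
  set H : SimpleGraph V := mono G (U ∪ X) (fun _ => ()) with hH
  have hHadj : ∀ a b, H.Adj a b ↔ G.Adj a b ∧ a ∈ U ∪ X ∧ b ∈ U ∪ X := by
    intro a b; simp [hH, mono_adj]
  by_cases hM : ∀ K : Finset V, Disjoint K D → X.card ≤ ((X \ K) ∪ nb H K).card
  · left
    obtain ⟨T, hT, hTc, f, b, hf⟩ := menger _ H X D X.card rfl hM
    have hTX : T = X := Finset.eq_of_subset_of_card_le hT hTc.ge
    subst hTX
    have hh : ∀ a ∈ T, ∃ b' ∈ D, Relation.ReflTransGen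
        (fun u v => (mono H Finset.univ f).Adj u v ∧ u ∉ D) a b' :=
      fun a ha => first_hit (hf a ha).2.2.2 (hf a ha).2.1
    choose! b' hb'D hb' using hh
    have hcol : ∀ a ∈ T, f (b' a) = a := by
      intro a ha
      have : (mono H Finset.univ f).Reachable a (b' a) := by
        have h := hb' a ha
        generalize b' a = z at h
        induction h with
        | refl => exact SimpleGraph.Reachable.refl _
        | tail _ h2 ih => exact ih.trans h2.1.reachable
      rw [← mono_const this, (hf a ha).1]
    have hb'Y : ∀ a ∈ T, b' a ∈ Y := by
      intro a ha
      rcases Relation.ReflTransGen.cases_tail (hb' a ha) with h | ⟨u, _, h, hu⟩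
      · have h1 := hb'D a ha
        rw [h] at h1 ⊢
        exact hXD a ha h1
      · exact hcore.ent u hu _ (hb'D a ha) ((hHadj _ _).1 h.1).1
    intro c
    obtain ⟨g, hg1, hg2⟩ := hcore.link (T.image b') (by
      intro z hz; obtain ⟨a, ha, rfl⟩ := Finset.mem_image.1 hz; exact hb'Y a ha)
      (Finset.card_image_le.trans hm) (fun v => c (f v))
    let F : V → C := fun v => if v ∈ D then g v else c (f v)
    have hFD : ∀ v, v ∈ D → F v = g v := fun v hv => by simp [F, hv]
    have hFn : ∀ v, v ∉ D → F v = c (f v) := fun v hv => by simp [F, hv]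
    have hgb : ∀ a ∈ T, F (b' a) = c a := by
      intro a ha
      rw [hFD _ (hb'D a ha), hg1 _ (Finset.mem_image_of_mem _ ha), hcol a ha]
    have key : ∀ a ∈ T, (mono G (U ∪ T) F).Reachable a (b' a) := by
      intro a ha
      have : ∀ u, Relation.ReflTransGen
        (fun u v => (mono H Finset.univ f).Adj u v ∧ u ∉ D) u (b' a) →
          f u = a ∧ (mono G (U ∪ T) F).Reachable u (b' a) := by
        intro u hu
        induction hu using Relation.ReflTransGen.head_induction_on with
        | refl => exact ⟨hcol a ha, SimpleGraph.Reachable.refl _⟩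
        | @head p q hpq hq ih =>
          obtain ⟨⟨h1, -, -, h2⟩, hp⟩ := hpq
          rw [hHadj] at h1
          have h3 : f p = a := h2.trans ih.1
          refine ⟨h3, SimpleGraph.Reachable.trans (SimpleGraph.Adj.reachable
            ⟨h1.1, h1.2.1, h1.2.2, ?_⟩) ih.2⟩
          rw [hFn p hp, h3]
          by_cases hqD : q ∈ D
          · rcases Relation.ReflTransGen.cases_head hq with h | ⟨z, h, -⟩
            · rw [h, hgb a ha]
            · exact absurd hqD h.2
          · rw [hFn q hqD, ih.1]
      exact (this a (hb' a ha)).2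
    refine ⟨F, fun x hx => ?_, fun x hx y hy hxy => ?_⟩
    · rw [mono_const (key x hx), hgb x hx]
    · refine (key x hx).trans (SimpleGraph.Reachable.trans ?_ (key y hy).symm)
      refine reach_mono_of (fun p q (h : (mono G D g).Adj p q) => ?_) (hg2 (b' x)
        (Finset.mem_image_of_mem _ hx) (b' y) (Finset.mem_image_of_mem _ hy) (by
          simp only [hcol x hx, hcol y hy, hxy]))
      obtain ⟨h1, h2, h3, h4⟩ := h
      exact SimpleGraph.Adj.reachable ⟨h1, hD h2, hD h3, by rw [hFD p h2, hFD q h3, h4]⟩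
  · right
    push Not at hM
    obtain ⟨K, hKD, hK⟩ := hM
    set S := X \ K ∪ nb H K with hS
    have hSsub : S ⊆ U ∪ X := by
      intro v hv
      rw [hS, Finset.mem_union, Finset.mem_sdiff, mem_nb] at hv
      rcases hv with h | ⟨-, w, -, h⟩
      · exact Finset.mem_union_right _ h.1
      · exact ((hHadj _ _).1 h).2.2
    have hKD' : ∀ v ∈ D, v ∉ K := fun v hv hk => Finset.disjoint_left.1 hKD hk hv
    refine ⟨U \ (K ∪ S), S, Finset.sdiff_subset, hSsub, ?_, ?_, ?_, ?_, hK⟩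
    · rw [Finset.disjoint_left]; intro v hv h; simp at hv; tauto
    · intro z hz
      obtain ⟨hz1, w, hw, hwz⟩ := mem_nb.1 hz
      simp only [Finset.mem_sdiff, Finset.mem_union, not_or] at hz1 hw
      have hzUX : z ∈ U ∪ X := by
        rw [Finset.mem_union]
        by_cases h : z ∈ U
        · exact Or.inl h
        · exact Or.inr (hN (mem_nb.2 ⟨h, w, hw.1, hwz⟩))
      by_cases hzK : z ∈ K
      · exfalso
        apply hw.2.2
        exact Finset.mem_union_right _ (mem_nb.2 ⟨hw.2.1, z, hzK, (hHadj _ _).2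
          ⟨hwz.symm, hzUX, Finset.mem_union_left _ hw.1⟩⟩)
      · rcases Finset.mem_union.1 hzUX with h | h
        · tauto
        · exact Finset.mem_union_left _ (Finset.mem_sdiff.2 ⟨h, hzK⟩)
    · intro d hd
      have h1 := hKD' d hd
      have h2 := hD hd
      have h3 : d ∈ X → d ∈ S := fun h => Finset.mem_union_left _ (Finset.mem_sdiff.2 ⟨h, h1⟩)
      rw [Finset.mem_union] at h2 ⊢
      simp only [Finset.mem_sdiff, Finset.mem_union]
      tauto
    · intro v hv hvD
      rw [hS, Finset.mem_union, Finset.mem_sdiff, mem_nb] at hv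
      rcases hv with h | ⟨-, w, hw, h⟩
      · exact hXD v h.1 hvD
      · exact hcore.ent w (fun h' => hKD' w h' hw) v hvD ((hHadj _ _).1 h).1

lemma core_linked {G : SimpleGraph V} {D Y : Finset V} {m : ℕ} (hcore : Core C G D Y m) (n : ℕ) :
    ∀ U X : Finset V, X.card = n → nb G U ⊆ X → Disjoint U X → D ⊆ U ∪ X →
    (∀ v ∈ X, v ∈ D → v ∈ Y) → X.card ≤ m →
    Linked C G U X ∨ ∃ W S : Finset V, W ⊆ U ∧ S ⊆ U ∪ X ∧ Disjoint W S ∧ nb G W ⊆ S ∧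
      D ⊆ W ∪ S ∧ (∀ v ∈ S, v ∈ D → v ∈ Y) ∧ S.card < X.card ∧ Linked C G W S := by
  induction n using Nat.strong_induction_on with
  | _ n IH =>
  intro U X hn hN hUX hD hXD hm
  rcases core_step hN hUX hD hXD hcore hm with h | ⟨W, S, h1, h2, h3, h4, h5, h6, h7⟩
  · exact Or.inl h
  · right
    rcases IH S.card (by omega) W S rfl h4 h3 h5 h6 (by omega) with
      h | ⟨W', S', g1, g2, g3, g4, g5, g6, g7, g8⟩
    · exact ⟨W, S, h1, h2, h3, h4, h5, h6, h7, h⟩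
    · exact ⟨W', S', g1.trans h1, g2.trans (Finset.union_subset
        (h1.trans Finset.subset_union_left) h2), g3, g4, g5, g6, by omega, g8⟩

/-- A linked pair is a core. -/
lemma Linked.core {G : SimpleGraph V} {W S : Finset V} (h : Linked C G W S) (hN : nb G W ⊆ S)
    (m : ℕ) : Core C G (W ∪ S) S m := by
  refine ⟨Finset.subset_union_right, ?_, ?_⟩
  · intro u hu d hd hud
    rw [Finset.mem_union] at hu hd
    by_contra hdS
    have hdW : d ∈ W := by tauto
    exact hu (Or.inr (hN (mem_nb.2 ⟨by tauto, d, hdW, hud.symm⟩)))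
  · intro T hT _ c
    obtain ⟨f, hf1, hf2⟩ := h c
    exact ⟨f, fun x hx => hf1 x (hT hx), fun x hx y hy => hf2 x (hT hx) y (hT hy)⟩

/-- Replace `W` by a clique on `S`. -/
def repl (G : SimpleGraph V) (W S : Finset V) : SimpleGraph V where
  Adj a b := (G.Adj a b ∧ a ∉ W ∧ b ∉ W) ∨ (a ∈ S ∧ b ∈ S ∧ a ≠ b)
  symm := ⟨fun a b h => h.imp (fun h => ⟨h.1.symm, h.2.2, h.2.1⟩)
    (fun h => ⟨h.2.1, h.1, h.2.2.symm⟩)⟩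
  loopless := ⟨fun x h => h.elim (fun h => G.loopless.irrefl x h.1) (fun h => h.2.2 rfl)⟩

lemma repl_adj {G : SimpleGraph V} {W S : Finset V} {a b : V} : (repl G W S).Adj a b ↔
    (G.Adj a b ∧ a ∉ W ∧ b ∉ W) ∨ (a ∈ S ∧ b ∈ S ∧ a ≠ b) := Iff.rfl

lemma linked_of_repl {G : SimpleGraph V} {W S Z X : Finset V} (h : Linked C G W S)
    (hWS : Disjoint W S) (hZ : Linked C (repl G W S) Z X) (hS : S ⊆ Z ∪ X)
    (hXW : Disjoint W X) : Linked C G (Z ∪ W) X := by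
  intro c
  obtain ⟨f, hf1, hf2⟩ := hZ c
  obtain ⟨g, hg1, hg2⟩ := h f
  let F : V → C := fun v => if v ∈ W then g v else f v
  have hFW : ∀ v, v ∉ W → F v = f v := fun v hv => by simp [F, hv]
  have hFg : ∀ v, v ∈ W ∪ S → F v = g v := by
    intro v hv
    by_cases hvW : v ∈ W
    · simp [F, hvW]
    · rw [hFW v hvW, hg1 v ((Finset.mem_union.1 hv).resolve_left hvW)]
  have hsub : Z ∪ X ⊆ Z ∪ W ∪ X := by
    intro v; simp only [Finset.mem_union]; tauto
  have hsub2 : W ∪ S ⊆ Z ∪ W ∪ X := by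
    intro v hv
    rcases Finset.mem_union.1 hv with h | h
    · simp [h]
    · exact hsub (hS h)
  refine ⟨F, fun x hx => ?_, fun x hx y hy hxy => ?_⟩
  · rw [hFW x (fun h => Finset.disjoint_left.1 hXW h hx), hf1 x hx]
  · refine reach_mono_of (fun p q (h : (mono (repl G W S) (Z ∪ X) f).Adj p q) => ?_)
      (hf2 x hx y hy hxy)
    obtain ⟨h1, h2, h3, h4⟩ := h
    rcases h1 with ⟨h1, hp, hq⟩ | ⟨hp, hq, -⟩
    · exact SimpleGraph.Adj.reachable ⟨h1, hsub h2, hsub h3, by rw [hFW p hp, hFW q hq, h4]⟩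
    · refine reach_mono_of (fun a b (h : (mono G (W ∪ S) g).Adj a b) => ?_) (hg2 p hp q hq h4)
      obtain ⟨k1, k2, k3, k4⟩ := h
      exact SimpleGraph.Adj.reachable ⟨k1, hsub2 k2, hsub2 k3, by rw [hFg a k2, hFg b k3, k4]⟩

structure Massed (l : ℕ) (G : SimpleGraph V) (U X : Finset V) : Prop where
  disj : Disjoint U X
  nbs : nb G U ⊆ X
  dense : l * U.card < rho G U
  small : ∀ W ⊆ U, (nb G W).card < X.card → rho G W ≤ l * W.card

lemma nb_disj {G : SimpleGraph V} {W : Finset V} : Disjoint W (nb G W) := by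
  rw [Finset.disjoint_left]; intro v hv h; exact (mem_nb.1 h).1 hv

lemma exists_massed {l : ℕ} {G : SimpleGraph V} (n : ℕ) : ∀ W : Finset V, (nb G W).card = n →
    l * W.card < rho G W →
    ∃ W' ⊆ W, Massed l G W' (nb G W') ∧ (nb G W').card ≤ (nb G W).card := by
  induction n using Nat.strong_induction_on with
  | _ n IH =>
  intro W hn hW
  by_cases h : ∀ W' ⊆ W, (nb G W').card < (nb G W).card → rho G W' ≤ l * W'.card
  · exact ⟨W, subset_rfl, ⟨nb_disj, subset_rfl, hW, h⟩, le_rfl⟩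
  · push Not at h
    obtain ⟨W', h1, h2, h3⟩ := h
    obtain ⟨W'', g1, g2, g3⟩ := IH _ (by omega) W' rfl h3
    exact ⟨W'', g1.trans h1, g2, by omega⟩

lemma rho_sub {G H : SimpleGraph V} {U W : Finset V}
    (h : ∀ a b, G.Adj a b → (a ∈ U ∨ b ∈ U) → H.Adj a b ∧ (a ∈ W ∨ b ∈ W)) :
    rho G U ≤ rho H W := by
  apply Finset.card_le_card
  rintro ⟨a, b⟩ hab
  rw [mem_rhoSet] at hab ⊢
  exact h a b hab.1 hab.2

lemma rho_repl {G : SimpleGraph V} {U W S : Finset V} :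
    rho G U ≤ rho (repl G W S) (U \ W) + rho G W := by
  refine (Finset.card_le_card ?_).trans (Finset.card_union_le _ _)
  rintro ⟨a, b⟩ hab
  rw [Finset.mem_union, mem_rhoSet, mem_rhoSet, repl_adj]
  rw [mem_rhoSet] at hab
  simp only [Finset.mem_sdiff]
  tauto

/-- Induction hypothesis of the main theorem. -/
def IndHyp (C : Type) (l K n : ℕ) (V : Type) [Fintype V] : Prop :=
  ∀ (G' : SimpleGraph V) (U' X' : Finset V), U'.card < n → X'.card ≤ K →
    Massed l G' U' X' → Linked C G' U' X'

lemma rigid_linked {l K : ℕ} {G : SimpleGraph V} {U X : Finset V} (hM : Massed l G U X)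
    (hX : X.card ≤ K) (IH : IndHyp C l K U.card V) (n : ℕ) :
    ∀ W S : Finset V, (U \ W).card = n → W ⊆ U → W.Nonempty → S ⊆ U ∪ X → Disjoint W S →
      nb G W ⊆ S → S.card < X.card → Linked C G W S → Linked C G U X := by
  induction n using Nat.strong_induction_on with
  | _ n IHn =>
  intro W S hn hWU hW hS hWS hN hSX hL
  have hWS' : ∀ v ∈ W, v ∉ S := fun v hv => Finset.disjoint_left.1 hWS hv
  have hUX' : ∀ v ∈ U, v ∉ X := fun v hv => Finset.disjoint_left.1 hM.disj hv
  have hnbU : ∀ w ∈ U, ∀ z, G.Adj w z → z ∈ U ∨ z ∈ X := by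
    intro w hw z hz
    by_cases h : z ∈ U
    · exact Or.inl h
    · exact Or.inr (hM.nbs (mem_nb.2 ⟨h, w, hw, hz⟩))
  have hS' : ∀ v ∈ S, v ∈ U ∨ v ∈ X := fun v hv => Finset.mem_union.1 (hS hv)
  have hnbW : ∀ w ∈ W, ∀ z, G.Adj w z → z ∈ W ∨ z ∈ S := by
    intro w hw z hz
    by_cases h : z ∈ W
    · exact Or.inl h
    · exact Or.inr (hN (mem_nb.2 ⟨h, w, hw, hz⟩))
  have hlt : (U \ W).card < U.card := by
    apply Finset.card_lt_card
    refine ⟨Finset.sdiff_subset, fun h => ?_⟩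
    obtain ⟨w, hw⟩ := hW
    exact (Finset.mem_sdiff.1 (h (hWU hw))).2 hw
  have hcardU : (U \ W).card + W.card = U.card := Finset.card_sdiff_add_card_eq_card hWU
  by_cases hsmall : ∀ Z ⊆ U \ W, (nb (repl G W S) Z).card < X.card →
      rho (repl G W S) Z ≤ l * Z.card
  · have hM' : Massed l (repl G W S) (U \ W) X := by
      refine ⟨hM.disj.mono_left Finset.sdiff_subset, ?_, ?_, hsmall⟩
      · intro z hz
        obtain ⟨h1, w, hw, hwz⟩ := mem_nb.1 hz
        rw [Finset.mem_sdiff] at h1 hw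
        rcases hwz with h | h
        · have := hnbU w hw.1 z h.1; tauto
        · have := hS' z h.2.1
          have := hWS' z
          tauto
      · have h1 := hM.dense
        have h2 := rho_repl (G := G) (U := U) (W := W) (S := S)
        have h3 := hM.small W hWU (lt_of_le_of_lt (Finset.card_le_card hN) hSX)
        rw [← hcardU, Nat.mul_add] at h1
        omega
    have h1 := IH _ _ _ hlt hX hM'
    have h2 := linked_of_repl hL hWS h1 (by
      intro v hv
      have := hS' v hv
      have := fun h => hWS' v h hv
      rw [Finset.mem_union, Finset.mem_sdiff]; tauto) (hM.disj.mono_left hWU)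
    rwa [Finset.sdiff_union_of_subset hWU] at h2
  · push Not at hsmall
    obtain ⟨Z0, hZ0, hZ1, hZ2⟩ := hsmall
    obtain ⟨Z, hZsub, hZM, hZc⟩ := exists_massed _ Z0 rfl hZ2
    set N := nb (repl G W S) Z with hNdef
    have hZU : ∀ v ∈ Z, v ∈ U ∧ v ∉ W := fun v hv => Finset.mem_sdiff.1 (hZ0 (hZsub hv))
    have hZL : Linked C (repl G W S) Z N :=
      IH _ _ _ (lt_of_le_of_lt (Finset.card_le_card (hZsub.trans hZ0)) hlt) (by omega) hZM
    by_cases hdj : ∃ s0 ∈ Z, s0 ∈ S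
    swap
    · exfalso
      push Not at hdj
      have h1 : nb G Z ⊆ N := by
        intro z hz
        obtain ⟨h1, w, hw, hwz⟩ := mem_nb.1 hz
        refine mem_nb.2 ⟨h1, w, hw, Or.inl ⟨hwz, (hZU w hw).2, fun h => ?_⟩⟩
        rcases hnbW z h w hwz.symm with h' | h'
        · exact (hZU w hw).2 h'
        · exact hdj w hw h'
      have h2 : rho (repl G W S) Z ≤ rho G Z := by
        apply rho_sub
        intro a b hab h
        refine ⟨?_, h⟩
        rcases hab with h' | h'
        · exact h'.1
        · rcases h with h | h
          · exact absurd h'.1 (hdj a h)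
          · exact absurd h'.2.1 (hdj b h)
      have h3 := hM.small Z (fun v hv => (hZU v hv).1)
        (lt_of_le_of_lt (Finset.card_le_card h1) (by omega))
      have := hZM.dense
      omega
    · obtain ⟨s0, hs0Z, hs0S⟩ := hdj
      have hSN : S ⊆ Z ∪ N := by
        intro v hv
        rw [Finset.mem_union]
        by_cases h : v ∈ Z
        · exact Or.inl h
        · refine Or.inr (mem_nb.2 ⟨h, s0, hs0Z, Or.inr ⟨hs0S, hv, ?_⟩⟩)
          rintro rfl; exact h hs0Z
      have hNW : ∀ v ∈ N, v ∉ W ∧ (v ∈ U ∨ v ∈ X) := by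
        intro v hv
        obtain ⟨h1, w, hw, hwz⟩ := mem_nb.1 hv
        rcases hwz with h | h
        · exact ⟨h.2.2, hnbU w (hZU w hw).1 v h.1⟩
        · exact ⟨fun h' => hWS' v h' h.2.1, hS' v h.2.1⟩
      have hWN : Disjoint W N := by
        rw [Finset.disjoint_left]; intro v hv h; exact (hNW v h).1 hv
      have hL2 := linked_of_repl hL hWS hZL hSN hWN
      refine IHn _ ?_ (Z ∪ W) N rfl ?_ ?_ ?_ ?_ ?_ (by omega) hL2
      · rw [← hn]
        apply Finset.card_lt_card
        refine ⟨fun v => by simp only [Finset.mem_sdiff, Finset.mem_union]; tauto, fun h => ?_⟩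
        have := h (Finset.mem_sdiff.2 (hZU s0 hs0Z))
        simp [hs0Z] at this
      · exact Finset.union_subset (fun v hv => (hZU v hv).1) hWU
      · exact ⟨s0, Finset.mem_union_left _ hs0Z⟩
      · intro v hv; exact Finset.mem_union.2 (hNW v hv).2
      · exact Finset.disjoint_union_left.2 ⟨nb_disj, hWN⟩
      · intro z hz
        obtain ⟨h1, w, hw, hwz⟩ := mem_nb.1 hz
        rw [Finset.mem_union, not_or] at h1
        rcases Finset.mem_union.1 hw with h | h
        · exact mem_nb.2 ⟨h1.1, w, h, Or.inl ⟨hwz, (hZU w h).2, h1.2⟩⟩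
        · have h2 := (hnbW w h z hwz).resolve_left h1.2
          exact (Finset.mem_union.1 (hSN h2)).resolve_left h1.1

lemma core_finish {l K m : ℕ} {G : SimpleGraph V} {U X D Y : Finset V} (hM : Massed l G U X)
    (hX : X.card ≤ K) (IH : IndHyp C l K U.card V) (hcore : Core C G D Y m)
    (hD : D ⊆ U ∪ X) (hXD : ∀ v ∈ X, v ∈ D → v ∈ Y) (hm : X.card ≤ m)
    (hne : ∀ W S : Finset V, D ⊆ W ∪ S → (∀ v ∈ S, v ∈ D → v ∈ Y) → S.card < X.card →
      W.Nonempty) : Linked C G U X := by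
  rcases core_linked hcore _ U X rfl hM.nbs hM.disj hD hXD hm with h |
    ⟨W, S, h1, h2, h3, h4, h5, h6, h7, h8⟩
  · exact h
  · exact rigid_linked hM hX IH _ W S rfl h1 (hne W S h5 h6 h7) h2 h3 h4 h7 h8

lemma no_small {l K : ℕ} {G : SimpleGraph V} {U X W : Finset V} (hM : Massed l G U X)
    (hX : X.card ≤ K) (IH : IndHyp C l K U.card V) (hWU : W ⊆ U) (hne : W ≠ U)
    (hW : (nb G W).card ≤ X.card) (hd : l * W.card < rho G W) : Linked C G U X := by
  obtain ⟨W', h1, h2, h3⟩ := exists_massed _ W rfl hd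
  have hlt : W'.card < U.card := lt_of_le_of_lt (Finset.card_le_card h1)
    (Finset.card_lt_card (Finset.ssubset_iff_subset_ne.2 ⟨hWU, hne⟩))
  have hL : Linked C G W' (nb G W') := IH _ _ _ hlt (by omega) h2
  refine core_finish hM hX IH (hL.core subset_rfl X.card) ?_ ?_ le_rfl ?_
  · intro v hv
    rcases Finset.mem_union.1 hv with h | h
    · exact Finset.mem_union_left _ (hWU (h1 h))
    · obtain ⟨g1, w, hw, g2⟩ := mem_nb.1 h
      rw [Finset.mem_union]
      by_cases hvU : v ∈ U
      · exact Or.inl hvU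
      · exact Or.inr (hM.nbs (mem_nb.2 ⟨hvU, w, hWU (h1 hw), g2⟩))
  · intro v hv hv'
    rcases Finset.mem_union.1 hv' with h | h
    · exact absurd hv (Finset.disjoint_left.1 hM.disj (hWU (h1 h)))
    · exact h
  · intro A S g1 g2 g3
    have hne' : W'.Nonempty := by
      rw [Finset.nonempty_iff_ne_empty]
      rintro rfl
      have := h2.dense
      simp [rho, rhoSet] at this
    obtain ⟨w, hw⟩ := hne'
    refine ⟨w, ?_⟩
    have hw1 : w ∈ W' ∪ nb G W' := Finset.mem_union_left _ hw
    rcases Finset.mem_union.1 (g1 hw1) with h | h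
    · exact h
    · exact absurd (g2 w h hw1) (Finset.disjoint_left.1 nb_disj hw)

lemma exists_nbr {l K : ℕ} {G : SimpleGraph V} {U X : Finset V} (hM : Massed l G U X)
    (hX : X.card ≤ K) (IH : IndHyp C l K U.card V) (hl : 2 * K ≤ l) {v : V} (hv : v ∈ U) :
    Linked C G U X ∨ ∃ w ∈ U, G.Adj v w := by
  by_contra hcon
  push Not at hcon
  obtain ⟨hnL, hno⟩ := hcon
  apply hnL
  refine no_small hM hX IH (W := U.erase v) (Finset.erase_subset _ _) ?_ ?_ ?_
  · intro h
    have := Finset.notMem_erase v U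
    rw [h] at this; exact this hv
  · apply Finset.card_le_card
    intro z hz
    obtain ⟨h1, w, hw, hwz⟩ := mem_nb.1 hz
    rw [Finset.mem_erase] at h1 hw
    refine hM.nbs (mem_nb.2 ⟨fun h => ?_, w, hw.2, hwz⟩)
    have : z = v := by tauto
    subst this
    exact hno w hw.2 hwz.symm
  · have h1 : rho G U ≤ rho G (U.erase v) + 2 * X.card := by
      have : rhoSet G U ⊆ rhoSet G (U.erase v) ∪ (X.image (fun x => (v, x)) ∪
          X.image (fun x => (x, v))) := by
        rintro ⟨a, b⟩ hab
        rw [mem_rhoSet] at hab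
        obtain ⟨hadj, hab⟩ := hab
        simp only [Finset.mem_union, mem_rhoSet, Finset.mem_image, Prod.mk.injEq,
          Finset.mem_erase]
        have hnX : ∀ z, G.Adj v z → z ∈ X := by
          intro z hz
          exact hM.nbs (mem_nb.2 ⟨fun h => hno z h hz, v, hv, hz⟩)
        by_cases ha : a = v
        · subst ha
          exact Or.inr (Or.inl ⟨b, hnX b hadj, rfl, rfl⟩)
        · by_cases hb : b = v
          · subst hb
            exact Or.inr (Or.inr ⟨a, hnX a hadj.symm, rfl, rfl⟩)
          · exact Or.inl ⟨hadj, by tauto⟩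
      have h2 := Finset.card_le_card this
      have h3 := Finset.card_union_le (rhoSet G (U.erase v)) (X.image (fun x => (v, x)) ∪
          X.image (fun x => (x, v)))
      have h4 := Finset.card_union_le (X.image (fun x => (v, x))) (X.image (fun x => (x, v)))
      have h5 := Finset.card_image_le (s := X) (f := fun x => (v, x))
      have h6 := Finset.card_image_le (s := X) (f := fun x => (x, v))
      unfold rho
      omega
    have h2 := hM.dense
    have h3 := Finset.card_erase_add_one hv
    rw [← h3, Nat.mul_add] at h2
    omega

lemma deletion {l K : ℕ} {G : SimpleGraph V} {U X : Finset V} (hM : Massed l G U X)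
    (hX : X.card ≤ K) (IH : IndHyp C l K U.card V)
    (IH2 : ∀ G' : SimpleGraph V, rho G' U < rho G U → Massed l G' U X → Linked C G' U X)
    {x y : V} (hx : x ∈ U) (hy : y ∈ U) (hxy : G.Adj x y) :
    Linked C G U X ∨ rho G U ≤ l * U.card + 2 := by
  by_contra hcon
  push Not at hcon
  obtain ⟨hnL, hbig⟩ := hcon
  have hle : ∀ a b, (del G x y).Adj a b → G.Adj a b := fun a b h => h.1
  have hlt : rho (del G x y) U < rho G U :=
    rho_lt_of hle hxy (Or.inl hx) (by simp [del_adj])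
  have hrho : rho G U ≤ rho (del G x y) U + 2 := by
    have : rhoSet G U ⊆ rhoSet (del G x y) U ∪ {(x, y), (y, x)} := by
      rintro ⟨a, b⟩ hab
      rw [mem_rhoSet] at hab
      simp only [Finset.mem_union, mem_rhoSet, del_adj, Finset.mem_insert, Finset.mem_singleton,
        Prod.mk.injEq]
      tauto
    have h2 := Finset.card_le_card this
    have h3 := Finset.card_union_le (rhoSet (del G x y) U) {(x, y), (y, x)}
    have h4 : ({(x, y), (y, x)} : Finset (V × V)).card ≤ 2 := Finset.card_le_two
    unfold rho
    omega
  have hnotM : ¬ Massed l (del G x y) U X := by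
    intro h
    apply hnL
    intro c
    obtain ⟨f, h1, h2⟩ := IH2 _ hlt h c
    refine ⟨f, h1, fun a ha b hb hab => ?_⟩
    exact reach_mono_of (fun p q (h : (mono (del G x y) (U ∪ X) f).Adj p q) =>
      SimpleGraph.Adj.reachable (G := mono G (U ∪ X) f) ⟨h.1.1, h.2⟩) (h2 a ha b hb hab)
  apply hnotM
  refine ⟨hM.disj, ?_, by omega, ?_⟩
  · intro z hz
    obtain ⟨h1, w, hw, hwz⟩ := mem_nb.1 hz
    exact hM.nbs (mem_nb.2 ⟨h1, w, hw, hwz.1⟩)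
  · intro W hW hWc
    by_contra hWd
    push Not at hWd
    have hr : rho (del G x y) W ≤ rho G W := rho_sub (fun a b h h' => ⟨h.1, h'⟩)
    by_cases hWU : W = U
    · subst hWU
      have : nb G W ⊆ nb (del G x y) W := by
        intro z hz
        obtain ⟨h1, w, hw, hwz⟩ := mem_nb.1 hz
        refine mem_nb.2 ⟨h1, w, hw, del_adj.2 ⟨hwz, ?_, ?_⟩⟩
        · rintro ⟨rfl, rfl⟩; exact h1 hy
        · rintro ⟨rfl, rfl⟩; exact h1 hx
      have h1 := Finset.card_le_card this
      have h2 := hM.small W subset_rfl (by omega)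
      have h3 := hM.dense
      omega
    · apply hnL
      refine no_small hM hX IH hW hWU ?_ (by omega)
      have : ∃ t, nb G W ⊆ insert t (nb (del G x y) W) := by
        by_cases hxW : x ∈ W
        · refine ⟨y, fun z hz => ?_⟩
          obtain ⟨h1, w, hw, hwz⟩ := mem_nb.1 hz
          rw [Finset.mem_insert]
          by_cases hzy : z = y
          · exact Or.inl hzy
          · refine Or.inr (mem_nb.2 ⟨h1, w, hw, del_adj.2 ⟨hwz, by tauto, ?_⟩⟩)
            rintro ⟨rfl, rfl⟩; exact h1 hxW
        · refine ⟨x, fun z hz => ?_⟩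
          obtain ⟨h1, w, hw, hwz⟩ := mem_nb.1 hz
          rw [Finset.mem_insert]
          by_cases hzy : z = x
          · exact Or.inl hzy
          · refine Or.inr (mem_nb.2 ⟨h1, w, hw, del_adj.2 ⟨hwz, ?_, by tauto⟩⟩)
            rintro ⟨rfl, rfl⟩; exact hxW hw
      obtain ⟨t, ht⟩ := this
      have h1 := Finset.card_le_card ht
      have h2 := Finset.card_insert_le t (nb (del G x y) W)
      omega

/-- Contract `u` into `v`. -/
def contr (G : SimpleGraph V) (u v : V) : SimpleGraph V where
  Adj a b := a ≠ u ∧ b ≠ u ∧ a ≠ b ∧ (G.Adj a b ∨ (a = v ∧ G.Adj u b) ∨ (b = v ∧ G.Adj u a))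
  symm := ⟨fun a b h => ⟨h.2.1, h.1, h.2.2.1.symm,
    h.2.2.2.elim (fun h => Or.inl h.symm) (fun h => Or.inr h.symm)⟩⟩
  loopless := ⟨fun x h => h.2.2.1 rfl⟩

lemma contr_adj {G : SimpleGraph V} {u v a b : V} : (contr G u v).Adj a b ↔
    a ≠ u ∧ b ≠ u ∧ a ≠ b ∧ (G.Adj a b ∨ (a = v ∧ G.Adj u b) ∨ (b = v ∧ G.Adj u a)) := Iff.rfl

lemma linked_of_contr {G : SimpleGraph V} {u v : V} {W X : Finset V} (huv : G.Adj u v)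
    (hv : v ∈ W) (huX : u ∉ X) (hL : Linked C (contr G u v) W X) :
    Linked C G (insert u W) X := by
  intro c
  obtain ⟨f, h1, h2⟩ := hL c
  let F : V → C := fun z => if z = u then f v else f z
  have hFu : F u = f v := by simp [F]
  have hF : ∀ z, z ≠ u → F z = f z := fun z hz => by simp [F, hz]
  have hsub : ∀ z ∈ W ∪ X, z ∈ insert u W ∪ X := by
    intro z; simp only [Finset.mem_union, Finset.mem_insert]; tauto
  have hu : u ∈ insert u W ∪ X := by simp
  have hvu : v ≠ u := huv.ne'
  have hvW : v ∈ insert u W ∪ X := by simp [hv]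
  refine ⟨F, fun x hx => ?_, fun x hx y hy hxy => ?_⟩
  · rw [hF x (by rintro rfl; exact huX hx), h1 x hx]
  · have huvR : (mono G (insert u W ∪ X) F).Reachable u v :=
      SimpleGraph.Adj.reachable ⟨huv, hu, hvW, by rw [hFu, hF v hvu]⟩
    refine reach_mono_of (fun p q (h : (mono (contr G u v) (W ∪ X) f).Adj p q) => ?_)
      (h2 x hx y hy hxy)
    obtain ⟨⟨hp, hq, hpq, hc⟩, hpR, hqR, hf⟩ := h
    rcases hc with h | ⟨rfl, h⟩ | ⟨rfl, h⟩
    · exact SimpleGraph.Adj.reachable ⟨h, hsub p hpR, hsub q hqR, by rw [hF p hp, hF q hq, hf]⟩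
    · refine huvR.symm.trans (SimpleGraph.Adj.reachable ⟨h, hu, hsub q hqR, ?_⟩)
      rw [hFu, hF q hq, hf]
    · refine SimpleGraph.Reachable.trans (SimpleGraph.Adj.reachable
        ⟨h.symm, hsub p hpR, hu, ?_⟩) huvR
      rw [hFu, hF p hp, hf]

/-- Common neighbours. -/
noncomputable def cn (G : SimpleGraph V) (u v : V) : Finset V :=
  Finset.univ.filter (fun w => G.Adj u w ∧ G.Adj v w)

lemma mem_cn {G : SimpleGraph V} {u v w : V} : w ∈ cn G u v ↔ G.Adj u w ∧ G.Adj v w := by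
  simp [cn]

lemma rho_contr {G : SimpleGraph V} {U : Finset V} {u v : V} (huv : G.Adj u v)
    (hv : v ∈ U) : rho G U ≤ rho (contr G u v) (U.erase u) + (2 * (cn G u v).card + 2) := by
  set bad : Finset (V × V) := ((cn G u v).image (fun w => (u, w)) ∪
    (cn G u v).image (fun w => (w, u))) ∪ {(u, v), (v, u)} with hbad
  have hb : bad.card ≤ 2 * (cn G u v).card + 2 := by
    have h3 := Finset.card_union_le ((cn G u v).image (fun w => (u, w)) ∪
      (cn G u v).image (fun w => (w, u))) {(u, v), (v, u)}
    have h4 := Finset.card_union_le ((cn G u v).image (fun w => (u, w)))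
      ((cn G u v).image (fun w => (w, u)))
    have h5 := Finset.card_image_le (s := cn G u v) (f := fun x => (u, x))
    have h6 := Finset.card_image_le (s := cn G u v) (f := fun x => (x, u))
    have h7 : ({(u, v), (v, u)} : Finset (V × V)).card ≤ 2 := Finset.card_le_two
    rw [hbad]
    omega
  have hbmem : ∀ a b, (a, b) ∈ bad ↔ (a = u ∧ b ∈ cn G u v) ∨ (b = u ∧ a ∈ cn G u v) ∨
      (a = u ∧ b = v) ∨ (a = v ∧ b = u) := by
    intro a b
    simp only [hbad, Finset.mem_union, Finset.mem_image, Finset.mem_insert, Finset.mem_singleton,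
      Prod.mk.injEq]
    grind
  let r : V → V := fun z => if z = u then v else z
  have hvu : v ≠ u := huv.ne'
  have hinj : (rhoSet G U \ bad).card ≤ (rhoSet (contr G u v) (U.erase u)).card := by
    refine Finset.card_le_card_of_injOn (fun p => (r p.1, r p.2)) ?_ ?_
    · rintro ⟨a, b⟩ hab
      simp only [Finset.coe_sdiff, Set.mem_diff, Finset.mem_coe, mem_rhoSet, hbmem, mem_cn] at hab
      simp only [Finset.mem_coe, mem_rhoSet, contr_adj, Finset.mem_erase, r]
      obtain ⟨⟨h1, h2⟩, h3⟩ := hab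
      have h4 := h1.symm
      have h5 := h1.ne
      by_cases ha : a = u
      · subst ha
        have hb : b ≠ a := h5.symm
        have hbv : b ≠ v := by tauto
        simp only [if_true, if_neg hb]
        exact ⟨⟨hvu, hb, hbv.symm, Or.inr (Or.inl ⟨trivial, h1⟩)⟩, Or.inl ⟨hvu, hv⟩⟩
      · by_cases hb : b = u
        · subst hb
          have hav : a ≠ v := by tauto
          simp only [if_true, if_neg ha]
          exact ⟨⟨ha, hvu, hav, Or.inr (Or.inr ⟨trivial, h4⟩)⟩, Or.inr ⟨hvu, hv⟩⟩
        · simp only [if_neg ha, if_neg hb]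
          exact ⟨⟨ha, hb, h5, Or.inl h1⟩, by tauto⟩
    · rintro ⟨a, b⟩ hab ⟨a', b'⟩ hab' heq
      simp only [Finset.coe_sdiff, Set.mem_diff, Finset.mem_coe, mem_rhoSet, hbmem, mem_cn]
        at hab hab'
      simp only [Prod.mk.injEq, r] at heq ⊢
      obtain ⟨⟨h1, -⟩, h3⟩ := hab
      obtain ⟨⟨h1', -⟩, h3'⟩ := hab'
      have h4 := h1.symm
      have h4' := h1'.symm
      have h5 := h1.ne
      have h5' := h1'.ne
      obtain ⟨e1, e2⟩ := heq
      clear hbmem hb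
      clear_value bad
      split_ifs at e1 e2 <;> grind
  have h1 := Finset.card_sdiff_add_card (rhoSet G U) bad
  have h2 : (rhoSet G U).card ≤ (rhoSet G U ∪ bad).card :=
    Finset.card_le_card Finset.subset_union_left
  unfold rho
  omega

lemma rho_contr_le {G : SimpleGraph V} {W : Finset V} {u v : V} (hvW : v ∉ W) :
    rho (contr G u v) W ≤ rho G W := by
  refine Finset.card_le_card_of_injOn (fun p => if G.Adj p.1 p.2 then p else
    if p.1 = v then (u, p.2) else (p.1, u)) ?_ ?_
  · rintro ⟨a, b⟩ hab
    simp only [Finset.mem_coe, mem_rhoSet, contr_adj] at hab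
    simp only [Finset.mem_coe]
    split_ifs with h1 h2
    · rw [mem_rhoSet]; tauto
    · rw [mem_rhoSet]; subst h2
      obtain ⟨⟨h1, h2, h3, h4⟩, h5⟩ := hab
      have : a ≠ b := h3
      tauto
    · rw [mem_rhoSet]
      obtain ⟨⟨h1, h2, h3, h4⟩, h5⟩ := hab
      have h6 : b = v ∧ G.Adj u a := by tauto
      refine ⟨h6.2.symm, ?_⟩
      obtain ⟨rfl, -⟩ := h6
      tauto
  · rintro ⟨a, b⟩ hab ⟨a', b'⟩ hab' heq
    simp only [Finset.mem_coe, mem_rhoSet, contr_adj] at hab hab'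
    simp only at heq
    split_ifs at heq <;> simp only [Prod.mk.injEq] at heq ⊢ <;> grind

lemma contraction {l K : ℕ} {G : SimpleGraph V} {U X : Finset V} (hM : Massed l G U X)
    (hX : X.card ≤ K) (IH : IndHyp C l K U.card V)
    {u v : V} (hu : u ∈ U) (hv : v ∈ U) (huv : G.Adj u v) :
    Linked C G U X ∨ l < 2 * (cn G u v).card + 2 := by
  by_contra hcon
  push Not at hcon
  obtain ⟨hnL, hsm⟩ := hcon
  have hvu : v ≠ u := huv.ne'
  have hv' : v ∈ U.erase u := Finset.mem_erase.2 ⟨hvu, hv⟩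
  have huX : u ∉ X := Finset.disjoint_left.1 hM.disj hu
  have hcard := Finset.card_erase_add_one hu
  have hnbU : ∀ w ∈ U, ∀ z, G.Adj w z → z ∈ U ∨ z ∈ X := by
    intro w hw z hz
    by_cases h : z ∈ U
    · exact Or.inl h
    · exact Or.inr (hM.nbs (mem_nb.2 ⟨h, w, hw, hz⟩))
  have hnbU' : ∀ w ∈ U, ∀ z, (contr G u v).Adj w z → z ≠ u ∧ (z ∈ U ∨ z ∈ X) := by
    intro w hw z hz
    obtain ⟨h1, h2, h3, h4⟩ := hz
    refine ⟨h2, ?_⟩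
    rcases h4 with h | ⟨-, h⟩ | ⟨h, -⟩
    · exact hnbU w hw z h
    · exact hnbU u hu z h
    · rw [h]; exact Or.inl hv
  have hnM : ¬ Massed l (contr G u v) (U.erase u) X := by
    intro h
    apply hnL
    have := linked_of_contr huv hv' huX (IH _ _ _ (by omega) hX h)
    rwa [Finset.insert_erase hu] at this
  apply hnM
  refine ⟨hM.disj.mono_left (Finset.erase_subset _ _), ?_, ?_, ?_⟩
  · intro z hz
    obtain ⟨h1, w, hw, hwz⟩ := mem_nb.1 hz
    have := hnbU' w (Finset.mem_of_mem_erase hw) z hwz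
    rw [Finset.mem_erase] at h1
    tauto
  · have h1 := rho_contr (U := U) huv hv
    have h2 := hM.dense
    rw [← hcard, Nat.mul_add] at h2
    omega
  · intro W0 hW0 hW1
    by_contra hW2
    push Not at hW2
    obtain ⟨W, hW, hWM, hWc⟩ := exists_massed _ W0 rfl hW2
    have hWU : ∀ w ∈ W, w ≠ u ∧ w ∈ U := fun w hw => Finset.mem_erase.1 (hW0 (hW hw))
    have hWcard : W.card < U.card := by
      have := Finset.card_le_card (hW.trans hW0)
      omega
    apply hnL
    by_cases hvW : v ∈ W
    · have hL := IH _ _ _ hWcard (by omega) hWM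
      have huN : u ∉ nb (contr G u v) W := by
        intro h
        obtain ⟨h1, w, hw, h⟩ := mem_nb.1 h
        exact h.2.1 rfl
      have hL2 := linked_of_contr huv hvW huN hL
      refine rigid_linked hM hX IH _ _ _ rfl ?_ ⟨u, Finset.mem_insert_self _ _⟩ ?_ ?_ ?_
        (by omega) hL2
      · intro z hz
        rcases Finset.mem_insert.1 hz with rfl | h
        · exact hu
        · exact (hWU z h).2
      · intro z hz
        obtain ⟨h1, w, hw, hwz⟩ := mem_nb.1 hz
        exact Finset.mem_union.2 (hnbU' w (hWU w hw).2 z hwz).2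
      · rw [Finset.disjoint_insert_left]
        exact ⟨huN, nb_disj⟩
      · intro z hz
        obtain ⟨h1, w, hw, hwz⟩ := mem_nb.1 hz
        rw [Finset.mem_insert, not_or] at h1
        rcases Finset.mem_insert.1 hw with rfl | h
        · refine mem_nb.2 ⟨h1.2, v, hvW, hvu, h1.1, ?_, Or.inr (Or.inl ⟨rfl, hwz⟩)⟩
          rintro rfl; exact h1.2 hvW
        · exact mem_nb.2 ⟨h1.2, w, h, (hWU w h).1, h1.1, hwz.ne, Or.inl hwz⟩
    · refine no_small hM hX IH (W := W) (fun w hw => (hWU w hw).2) ?_ ?_ ?_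
      · rintro rfl; exact hvW hv
      · have : nb G W ⊆ insert u (nb (contr G u v) W) := by
          intro z hz
          obtain ⟨h1, w, hw, hwz⟩ := mem_nb.1 hz
          rw [Finset.mem_insert]
          by_cases hzu : z = u
          · exact Or.inl hzu
          · exact Or.inr (mem_nb.2 ⟨h1, w, hw, (hWU w hw).1, hzu, hwz.ne, Or.inl hwz⟩)
        have h1 := Finset.card_le_card this
        have h2 := Finset.card_insert_le u (nb (contr G u v) W)
        omega
      · have := rho_contr_le (G := G) (u := u) hvW
        have := hWM.dense
        omega

/-- Any two vertices of `D` can be joined through `D` by a short path avoiding a small set. -/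
def ShortConn (G : SimpleGraph V) (D : Finset V) (m : ℕ) : Prop :=
  ∀ R : Finset V, R.card ≤ m → ∀ x ∈ D, ∀ y ∈ D, ∃ p q, p ∈ D ∧ p ∉ R ∧ q ∈ D ∧ q ∉ R ∧
    G.Adj x p ∧ (p = q ∨ G.Adj p q) ∧ G.Adj q y

lemma greedy_aux {G : SimpleGraph V} {D : Finset V} {K : ℕ} (hP : ShortConn G D (3 * K))
    {T : Finset V} (hT : T ⊆ D) (hTK : T.card ≤ K) (c : V → C) (T' : Finset V) :
    T' ⊆ T → ∃ (f : V → C) (Q : Finset V), T ⊆ Q ∧ Q ⊆ D ∧ Q.card ≤ T.card + 2 * T'.card ∧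
      (∀ x ∈ T, f x = c x) ∧
      ∀ x ∈ T', ∀ y ∈ T', c x = c y → (mono G Q f).Reachable x y := by
  induction T' using Finset.induction_on with
  | empty =>
    intro _
    exact ⟨c, T, subset_rfl, hT, by simp, fun _ _ => rfl, by simp⟩
  | insert t T' ht ih =>
    intro hsub
    have htT : t ∈ T := hsub (Finset.mem_insert_self _ _)
    have hT'T : T' ⊆ T := fun x hx => hsub (Finset.mem_insert_of_mem hx)
    obtain ⟨f, Q, h1, h2, h3, h4, h5⟩ := ih hT'T
    rw [Finset.card_insert_of_notMem ht]
    by_cases hex : ∃ t' ∈ T', c t' = c t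
    · obtain ⟨t', ht', hct⟩ := hex
      have hc1 : T'.card + 1 ≤ T.card := by
        rw [← Finset.card_insert_of_notMem ht]; exact Finset.card_le_card hsub
      obtain ⟨p, q, hpD, hpQ, hqD, hqQ, e1, e2, e3⟩ :=
        hP Q (by omega) t' (hT (hT'T ht')) t (hT htT)
      let F : V → C := fun z => if z = p ∨ z = q then c t else f z
      have hFp : F p = c t := by simp [F]
      have hFq : F q = c t := by simp [F]
      have hF : ∀ z ∈ Q, F z = f z := by
        intro z hz
        have : ¬ (z = p ∨ z = q) := by
          rintro (rfl | rfl)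
          · exact hpQ hz
          · exact hqQ hz
        simp [F, this]
      have hFT : ∀ z ∈ T, F z = c z := fun z hz => by rw [hF z (h1 hz), h4 z hz]
      have hQ' : ∀ z ∈ Q, z ∈ insert p (insert q Q) := fun z hz => by simp [hz]
      have hold : ∀ x y, (mono G Q f).Reachable x y →
          (mono G (insert p (insert q Q)) F).Reachable x y := by
        intro x y hxy
        refine reach_mono_of (fun a b hab => ?_) hxy
        obtain ⟨g1, g2, g3, g4⟩ := hab
        exact SimpleGraph.Adj.reachable ⟨g1, hQ' a g2, hQ' b g3, by rw [hF a g2, hF b g3, g4]⟩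
      have hnew : (mono G (insert p (insert q Q)) F).Reachable t' t := by
        have r1 : (mono G (insert p (insert q Q)) F).Reachable t' p :=
          SimpleGraph.Adj.reachable ⟨e1, hQ' _ (h1 (hT'T ht')), by simp,
            by rw [hFT t' (hT'T ht'), hFp, hct]⟩
        have r2 : (mono G (insert p (insert q Q)) F).Reachable p q := by
          rcases e2 with e2 | e2
          · rw [e2]
          · exact SimpleGraph.Adj.reachable ⟨e2, by simp, by simp, by rw [hFp, hFq]⟩
        have r3 : (mono G (insert p (insert q Q)) F).Reachable q t :=
          SimpleGraph.Adj.reachable ⟨e3, by simp, hQ' _ (h1 htT), by rw [hFT t htT, hFq]⟩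
        exact r1.trans (r2.trans r3)
      refine ⟨F, insert p (insert q Q), fun z hz => hQ' z (h1 hz), ?_, ?_, hFT, ?_⟩
      · intro z hz
        rw [Finset.mem_insert, Finset.mem_insert] at hz
        rcases hz with rfl | rfl | hz
        · exact hpD
        · exact hqD
        · exact h2 hz
      · have := Finset.card_insert_le p (insert q Q)
        have := Finset.card_insert_le q Q
        omega
      · intro x hx y hy hxy
        rcases Finset.mem_insert.1 hx with rfl | hx2
        · rcases Finset.mem_insert.1 hy with rfl | hy
          · exact SimpleGraph.Reachable.refl _
          · exact hnew.symm.trans (hold _ _ (h5 t' ht' y hy (hct.trans hxy)))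
        · rcases Finset.mem_insert.1 hy with rfl | hy
          · exact (hold _ _ (h5 x hx2 t' ht' (hxy.trans hct.symm))).trans hnew
          · exact hold _ _ (h5 x hx2 y hy hxy)
    · push Not at hex
      refine ⟨f, Q, h1, h2, by omega, h4, ?_⟩
      intro x hx y hy hxy
      rcases Finset.mem_insert.1 hx with rfl | hx2
      · rcases Finset.mem_insert.1 hy with rfl | hy
        · exact SimpleGraph.Reachable.refl _
        · exact absurd hxy.symm (hex y hy)
      · rcases Finset.mem_insert.1 hy with rfl | hy
        · exact absurd hxy (hex x hx2)
        · exact h5 x hx2 y hy hxy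

lemma greedy_core {G : SimpleGraph V} {D : Finset V} {K : ℕ} (hP : ShortConn G D (3 * K)) :
    Core C G D D K := by
  refine ⟨subset_rfl, fun _ _ d hd _ => hd, ?_⟩
  intro T hT hTK c
  obtain ⟨f, Q, h1, h2, h3, h4, h5⟩ := greedy_aux hP hT hTK c T subset_rfl
  refine ⟨f, h4, fun x hx y hy hxy => reach_mono_of (fun a b hab => ?_) (h5 x hx y hy hxy)⟩
  obtain ⟨g1, g2, g3, g4⟩ := hab
  exact SimpleGraph.Adj.reachable ⟨g1, h2 g2, h2 g3, g4⟩

/-- Neighbours of `v` in `D`. -/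
noncomputable def nbin (G : SimpleGraph V) (D : Finset V) (v : V) : Finset V :=
  D.filter (fun w => G.Adj v w)

lemma mem_nbin {G : SimpleGraph V} {D : Finset V} {v w : V} :
    w ∈ nbin G D v ↔ w ∈ D ∧ G.Adj v w := by simp [nbin]

lemma dense_core {G : SimpleGraph V} {D : Finset V} {K : ℕ} (hK : 1 ≤ K) (hne : D.Nonempty)
    (hD : D.card ≤ 64 * K + 2) (hdeg : ∀ w ∈ D, 31 * K ≤ (nbin G D w).card) :
    ∃ D', D' ⊆ D ∧ K < D'.card ∧ ShortConn G D' (3 * K) := by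
  by_cases hP : ShortConn G D (3 * K)
  · refine ⟨D, subset_rfl, ?_, hP⟩
    obtain ⟨w, hw⟩ := hne
    have h1 := hdeg w hw
    have h2 : (nbin G D w).card ≤ D.card := Finset.card_le_card (Finset.filter_subset _ _)
    omega
  · unfold ShortConn at hP
    push Not at hP
    obtain ⟨R, hR, x, hx, y, hy, hno⟩ := hP
    set A := nbin G D x \ R with hA
    set B := nbin G D y \ R with hB
    have hAm : ∀ a, a ∈ A ↔ (a ∈ D ∧ G.Adj x a) ∧ a ∉ R := by
      intro a; rw [hA, Finset.mem_sdiff, mem_nbin]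
    have hBm : ∀ a, a ∈ B ↔ (a ∈ D ∧ G.Adj y a) ∧ a ∉ R := by
      intro a; rw [hB, Finset.mem_sdiff, mem_nbin]
    have hAB : ∀ a ∈ A, ∀ b ∈ B, a ≠ b ∧ ¬ G.Adj a b := by
      intro a ha b hb
      rw [hAm] at ha
      rw [hBm] at hb
      have := hno a b ha.1.1 ha.2 hb.1.1 hb.2 ha.1.2
      constructor
      · intro h
        exact this (Or.inl h) hb.1.2.symm
      · intro h
        exact this (Or.inr h) hb.1.2.symm
    have hAc : 28 * K ≤ A.card := by
      have h1 := hdeg x hx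
      have h2 := Finset.le_card_sdiff R (nbin G D x)
      rw [← hA] at h2
      omega
    have hBc : 28 * K ≤ B.card := by
      have h1 := hdeg y hy
      have h2 := Finset.le_card_sdiff R (nbin G D y)
      rw [← hB] at h2
      omega
    clear_value A B
    have hdis : Disjoint A B := by
      rw [Finset.disjoint_left]
      intro a ha hb
      exact (hAB a ha a hb).1 rfl
    have hABD : A ∪ B ⊆ D := by
      intro z hz
      rcases Finset.mem_union.1 hz with h | h
      · exact ((hAm z).1 h).1.1
      · exact ((hBm z).1 h).1.1
    have hABc : A.card + B.card + (D \ (A ∪ B)).card = D.card := by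
      rw [← Finset.card_union_of_disjoint hdis, add_comm]
      exact Finset.card_sdiff_add_card_eq_card hABD
    have hAdeg : ∀ a ∈ A, 23 * K ≤ (nbin G A a).card + 2 := by
      intro a ha
      have h1 := hdeg a ((hAm a).1 ha).1.1
      have h2 : nbin G D a ⊆ nbin G A a ∪ (D \ (A ∪ B)) := by
        intro z hz
        rw [mem_nbin] at hz
        rw [Finset.mem_union, mem_nbin, Finset.mem_sdiff, Finset.mem_union]
        have := hAB a ha z
        tauto
      have h3 := (Finset.card_le_card h2).trans (Finset.card_union_le _ _)
      omega
    refine ⟨A, fun z hz => ((hAm z).1 hz).1.1, by omega, ?_⟩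
    intro R' hR' u hu v hv
    have h1 := hAdeg u hu
    have h2 := hAdeg v hv
    have h3 := Finset.card_union_add_card_inter (nbin G A u) (nbin G A v)
    have h4 : (nbin G A u ∪ nbin G A v).card ≤ A.card :=
      Finset.card_le_card (Finset.union_subset (Finset.filter_subset _ _)
        (Finset.filter_subset _ _))
    have h5 : R'.card < (nbin G A u ∩ nbin G A v).card := by omega
    obtain ⟨p, hp, hpR⟩ := Finset.exists_mem_notMem_of_card_lt_card h5
    rw [Finset.mem_inter, mem_nbin, mem_nbin] at hp
    exact ⟨p, p, hp.1.1, hpR, hp.1.1, hpR, hp.1.2, Or.inl rfl, hp.2.2.symm⟩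

lemma sum_deg_le {G : SimpleGraph V} {U : Finset V} :
    ∑ u ∈ U, (nbin G Finset.univ u).card ≤ rho G U := by
  rw [← Finset.card_sigma]
  refine Finset.card_le_card_of_injOn (fun p => (p.1, p.2)) ?_ ?_
  · rintro ⟨a, b⟩ hab
    simp only [Finset.coe_sigma, Set.mem_sigma_iff, Finset.mem_coe, mem_nbin] at hab
    rw [Finset.mem_coe, mem_rhoSet]
    exact ⟨hab.2.2, Or.inl hab.1⟩
  · rintro ⟨a, b⟩ - ⟨a', b'⟩ - h
    simp only [Prod.mk.injEq] at h
    obtain ⟨rfl, rfl⟩ := h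
    rfl

lemma main_step {K : ℕ} (hK : 1 ≤ K) {G : SimpleGraph V} {U X : Finset V}
    (hM : Massed (64 * K) G U X) (hX : X.card ≤ K) (IH : IndHyp C (64 * K) K U.card V)
    (IH2 : ∀ G' : SimpleGraph V, rho G' U < rho G U → Massed (64 * K) G' U X →
      Linked C G' U X) : Linked C G U X := by
  by_contra hnL
  have hnbr : ∀ v ∈ U, ∃ w ∈ U, G.Adj v w := fun v hv =>
    (exists_nbr hM hX IH (by omega) hv).resolve_left hnL
  have hUne : U.Nonempty := by
    rw [Finset.nonempty_iff_ne_empty]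
    rintro rfl
    have := hM.dense
    simp [rho, rhoSet] at this
  obtain ⟨x, hx⟩ := hUne
  obtain ⟨y, hy, hxy⟩ := hnbr x hx
  have hrho := (deletion hM hX IH IH2 hx hy hxy).resolve_left hnL
  have hv : ∃ v ∈ U, (nbin G Finset.univ v).card ≤ 64 * K + 2 := by
    by_contra hcon
    push Not at hcon
    have h1 : U.card * (64 * K + 3) ≤ ∑ u ∈ U, (nbin G Finset.univ u).card := by
      rw [← smul_eq_mul]
      exact Finset.card_nsmul_le_sum _ _ _ (fun u hu => hcon u hu)
    have h2 := h1.trans (sum_deg_le.trans hrho)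
    have h3 : 1 ≤ U.card := Finset.card_pos.2 ⟨x, hx⟩
    nlinarith
  obtain ⟨v, hv, hdv⟩ := hv
  obtain ⟨D, hD, hDc, hDP⟩ : ∃ D', D' ⊆ nbin G U v ∧ K < D'.card ∧ ShortConn G D' (3 * K) := by
    apply dense_core hK
    · obtain ⟨w, hw, hvw⟩ := hnbr v hv
      exact ⟨w, mem_nbin.2 ⟨hw, hvw⟩⟩
    · refine (Finset.card_le_card ?_).trans hdv
      intro z hz
      rw [mem_nbin] at hz ⊢
      exact ⟨Finset.mem_univ _, hz.2⟩
    · intro w hw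
      rw [mem_nbin] at hw
      have h1 := (contraction hM hX IH hw.1 hv hw.2.symm).resolve_left hnL
      have h2 : cn G w v ⊆ nbin G (nbin G U v) w ∪ X := by
        intro z hz
        rw [mem_cn] at hz
        rw [Finset.mem_union, mem_nbin, mem_nbin]
        by_cases hzU : z ∈ U
        · exact Or.inl ⟨⟨hzU, hz.2⟩, hz.1⟩
        · exact Or.inr (hM.nbs (mem_nb.2 ⟨hzU, v, hv, hz.2⟩))
      have h3 := (Finset.card_le_card h2).trans (Finset.card_union_le _ _)
      omega
  apply hnL
  have hDU : D ⊆ U := fun z hz => (mem_nbin.1 (hD hz)).1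
  refine core_finish hM hX IH (greedy_core (C := C) hDP) (hDU.trans Finset.subset_union_left)
    (fun v _ hv => hv) hX ?_
  intro W S h1 _ h2
  rw [Finset.nonempty_iff_ne_empty]
  rintro rfl
  rw [Finset.empty_union] at h1
  have := Finset.card_le_card h1
  omega

theorem massed_linked {K : ℕ} (hK : 1 ≤ K) (n : ℕ) : ∀ (G : SimpleGraph V) (U X : Finset V),
    U.card = n → X.card ≤ K → Massed (64 * K) G U X → Linked C G U X := by
  induction n using Nat.strong_induction_on with
  | _ n IHn =>
  intro G U X hn
  generalize hr : rho G U = r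
  induction r using Nat.strong_induction_on generalizing G with
  | _ r IHr =>
  intro hX hM
  refine main_step hK hM hX ?_ ?_
  · intro G' U' X' h1 h2 h3
    exact IHn _ (by omega) G' U' X' rfl h2 h3
  · intro G' h1 h2
    exact IHr _ (by omega) G' rfl hX h2

/-- Twice the number of edges inside `S`. -/
noncomputable def ee (G : SimpleGraph V) (S : Finset V) : ℕ :=
  ((S ×ˢ S).filter (fun p : V × V => G.Adj p.1 p.2)).card

lemma ee_le_sq {G : SimpleGraph V} {S : Finset V} : ee G S ≤ S.card * S.card := by
  rw [← Finset.card_product]; exact Finset.card_filter_le _ _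

lemma ee_split {G : SimpleGraph V} {S S1 S2 : Finset V}
    (h : ∀ x ∈ S, ∀ y ∈ S, G.Adj x y → (x ∈ S1 ∧ y ∈ S1) ∨ (x ∈ S2 ∧ y ∈ S2)) :
    ee G S ≤ ee G S1 + ee G S2 := by
  refine (Finset.card_le_card ?_).trans (Finset.card_union_le _ _)
  rintro ⟨x, y⟩ hxy
  simp only [Finset.mem_union, Finset.mem_filter, Finset.mem_product] at hxy ⊢
  have := h x hxy.1.1 y hxy.1.2 hxy.2
  tauto

lemma ee_erase {G : SimpleGraph V} {S : Finset V} {v : V} :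
    ee G S ≤ ee G (S.erase v) + 2 * (nbin G S v).card := by
  have : (S ×ˢ S).filter (fun p : V × V => G.Adj p.1 p.2) ⊆
      ((S.erase v ×ˢ S.erase v).filter (fun p : V × V => G.Adj p.1 p.2)) ∪
      ((nbin G S v).image (fun w => (v, w)) ∪ (nbin G S v).image (fun w => (w, v))) := by
    rintro ⟨x, y⟩ hxy
    simp only [Finset.mem_union, Finset.mem_filter, Finset.mem_product, Finset.mem_erase,
      Finset.mem_image, mem_nbin, Prod.mk.injEq] at hxy ⊢
    obtain ⟨⟨h1, h2⟩, h3⟩ := hxy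
    by_cases hx : x = v
    · subst hx
      exact Or.inr (Or.inl ⟨y, ⟨h2, h3⟩, rfl, rfl⟩)
    · by_cases hy : y = v
      · subst hy
        exact Or.inr (Or.inr ⟨x, ⟨h1, h3.symm⟩, rfl, rfl⟩)
      · exact Or.inl ⟨⟨⟨hx, h1⟩, hy, h2⟩, h3⟩
  have h1 := (Finset.card_le_card this).trans (Finset.card_union_le _ _)
  have h2 := Finset.card_union_le ((nbin G S v).image (fun w => (v, w)))
    ((nbin G S v).image (fun w => (w, v)))
  have h3 := Finset.card_image_le (s := nbin G S v) (f := fun x => (v, x))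
  have h4 := Finset.card_image_le (s := nbin G S v) (f := fun x => (x, v))
  unfold ee
  omega

lemma ee_univ (G : SimpleGraph V) : ee G Finset.univ = 2 * G.edgeSet.ncard := by
  have h1 : G.edgeSet.ncard = G.edgeFinset.card := by
    rw [← Set.ncard_coe_finset, SimpleGraph.coe_edgeFinset]
  rw [h1, ← SimpleGraph.sum_degrees_eq_twice_card_edges]
  unfold ee
  rw [Finset.card_filter, Finset.sum_product]
  refine Finset.sum_congr rfl fun v _ => ?_
  rw [← SimpleGraph.card_neighborFinset_eq_degree, SimpleGraph.neighborFinset_eq_filter,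
    Finset.card_filter]

lemma mader_sub {G : SimpleGraph V} {κ : ℕ} (hκ : 1 ≤ κ) (hn : 0 < Fintype.card V)
    (he : 256 * κ * Fintype.card V ≤ ee G Finset.univ) :
    ∃ S : Finset V, S.Nonempty ∧ (∀ v ∈ S, 128 * κ < (nbin G S v).card) ∧
      ∀ W ⊆ S, W.Nonempty → (nb G W ∩ S).card < κ → S ⊆ W ∪ (nb G W ∩ S) := by
  let P : Finset V → Prop := fun S => 2 * κ ≤ S.card ∧ 256 * κ * S.card < ee G S + 256 * κ * κ
  have hP0 : P Finset.univ := by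
    have hpos : 0 < 256 * κ * κ := by positivity
    refine ⟨?_, by rw [Finset.card_univ]; omega⟩
    have h1 := he.trans ee_le_sq
    rw [Finset.card_univ] at h1 ⊢
    have h2 := Nat.le_of_mul_le_mul_right h1 hn
    omega
  obtain ⟨S, hS, hmin⟩ := Finset.exists_min_image (Finset.univ.filter P) Finset.card
    ⟨Finset.univ, by simpa using hP0⟩
  rw [Finset.mem_filter] at hS
  obtain ⟨-, hS1, hS2⟩ := hS
  have hmin' : ∀ S' : Finset V, S'.card < S.card → 2 * κ ≤ S'.card →
      ee G S' + 256 * κ * κ ≤ 256 * κ * S'.card := by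
    intro S' h1 h2
    by_contra h3
    have := hmin S' (by rw [Finset.mem_filter]; exact ⟨Finset.mem_univ _, h2, by omega⟩)
    omega
  have hne : 2 * κ < S.card := by
    rcases hS1.lt_or_eq with h | h
    · exact h
    · exfalso
      have h1 := ee_le_sq (G := G) (S := S)
      rw [← h] at hS2 h1
      nlinarith
  have hdeg : ∀ v ∈ S, 128 * κ < (nbin G S v).card := by
    intro v hv
    have h1 := Finset.card_erase_add_one hv
    have h2 := hmin' (S.erase v) (by omega) (by omega)
    have h3 := ee_erase (G := G) (S := S) (v := v)
    rw [← h1, Nat.mul_add] at hS2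
    omega
  refine ⟨S, Finset.card_pos.1 (by omega), hdeg, ?_⟩
  intro W hWS hW hN
  by_contra hcon
  rw [Finset.not_subset] at hcon
  obtain ⟨z, hz, hzn⟩ := hcon
  have hsub : W ∪ (nb G W ∩ S) ⊆ S := Finset.union_subset hWS Finset.inter_subset_right
  have hc1 : (W ∪ (nb G W ∩ S)).card < S.card :=
    Finset.card_lt_card (Finset.ssubset_iff_subset_ne.2 ⟨hsub, fun h => hzn (by rw [h]; exact hz)⟩)
  have hc2 : (S \ W).card + W.card = S.card := Finset.card_sdiff_add_card_eq_card hWS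
  have hc3 : (W ∪ (nb G W ∩ S)).card = W.card + (nb G W ∩ S).card := by
    apply Finset.card_union_of_disjoint
    rw [Finset.disjoint_left]
    intro a ha hb
    exact (mem_nb.1 (Finset.mem_inter.1 hb).1).1 ha
  have hWpos := Finset.card_pos.2 hW
  obtain ⟨w, hw⟩ := hW
  have hd1 : nbin G S w ⊆ W ∪ (nb G W ∩ S) := by
    intro a ha
    rw [mem_nbin] at ha
    rw [Finset.mem_union, Finset.mem_inter, mem_nb]
    by_cases haW : a ∈ W
    · exact Or.inl haW
    · exact Or.inr ⟨⟨haW, w, hw, ha.2⟩, ha.1⟩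
  have hd2 : nbin G S z ⊆ S \ W := by
    intro a ha
    rw [mem_nbin] at ha
    rw [Finset.mem_sdiff]
    refine ⟨ha.1, fun haW => hzn ?_⟩
    rw [Finset.mem_union, Finset.mem_inter, mem_nb]
    by_cases hzW : z ∈ W
    · exact Or.inl hzW
    · exact Or.inr ⟨⟨hzW, a, haW, ha.2.symm⟩, hz⟩
  have h1 := (hdeg w (hWS hw)).trans_le (Finset.card_le_card hd1)
  have h2 := (hdeg z hz).trans_le (Finset.card_le_card hd2)
  have h3 := hmin' _ hc1 (by omega)
  have h4 := hmin' (S \ W) (by omega) (by omega)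
  have h5 : ee G S ≤ ee G (W ∪ (nb G W ∩ S)) + ee G (S \ W) := by
    apply ee_split
    intro x hx y hy hxy
    simp only [Finset.mem_union, Finset.mem_inter, Finset.mem_sdiff, mem_nb]
    by_cases hxW : x ∈ W
    · left
      refine ⟨Or.inl hxW, ?_⟩
      by_cases hyW : y ∈ W
      · exact Or.inl hyW
      · exact Or.inr ⟨⟨hyW, x, hxW, hxy⟩, hy⟩
    · by_cases hyW : y ∈ W
      · left
        exact ⟨Or.inr ⟨⟨hxW, y, hyW, hxy.symm⟩, hx⟩, Or.inl hyW⟩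
      · right
        exact ⟨⟨hx, hxW⟩, hy, hyW⟩
  have h6 : 256 * κ * (W ∪ (nb G W ∩ S)).card + 256 * κ * (S \ W).card =
      256 * κ * S.card + 256 * κ * (nb G W ∩ S).card := by
    rw [hc3, ← hc2]; ring
  have h7 : 256 * κ * (nb G W ∩ S).card ≤ 256 * κ * κ := Nat.mul_le_mul_left _ hN.le
  omega

lemma mono_walk {G : SimpleGraph V} {R : Finset V} {f : V → C} {x y : V}
    (w : (mono G R f).Walk x y) : x ∈ R → ∀ v ∈ w.support, v ∈ R ∧ f v = f x := by
  induction w with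
  | nil => intro h v hv; simp at hv; subst hv; exact ⟨h, rfl⟩
  | cons hadj p ih =>
    intro h v hv
    rw [SimpleGraph.Walk.support_cons, List.mem_cons] at hv
    rcases hv with rfl | hv
    · exact ⟨h, rfl⟩
    · have := ih hadj.2.2.1 v hv
      exact ⟨this.1, this.2.trans hadj.2.2.2.symm⟩

lemma branch_paths {G : SimpleGraph V} {h : ℕ} (hh : 0 < h) (hn : 0 < Fintype.card V)
    (he : 256 * (h * h) * Fintype.card V ≤ ee G Finset.univ) :
    ∃ (b : Fin h → V) (f : V → Sym2 (Fin h)), Function.Injective b ∧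
      ∀ i j, i ≠ j → ∃ w : G.Walk (b i) (b j), w.IsPath ∧ ∀ v ∈ w.support,
        v = b i ∨ v = b j ∨ (v ∉ Set.range b ∧ f v = s(i, j)) := by
  have hhh : h ≤ h * h := Nat.le_mul_of_pos_left h hh
  obtain ⟨S, ⟨s0, hs0⟩, hdeg, hsep⟩ := mader_sub (by omega : 1 ≤ h * h) hn he
  have hScard : 128 * (h * h) < S.card :=
    (hdeg s0 hs0).trans_le (Finset.card_le_card (Finset.filter_subset _ _))
  obtain ⟨B, hBS, hB⟩ := Finset.exists_subset_card_eq (show h ≤ S.card by omega)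
  let b : Fin h → V := fun i => ((B.equivFinOfCardEq hB).symm i : V)
  have hbinj : Function.Injective b := fun i j hij =>
    (B.equivFinOfCardEq hB).symm.injective (Subtype.ext hij)
  have hbB : ∀ i, b i ∈ B := fun i => ((B.equivFinOfCardEq hB).symm i).2
  clear_value b
  have hdegB : ∀ v ∈ S, 127 * (h * h) < (nbin G S v \ B).card := by
    intro v hv
    have h1 := hdeg v hv
    have h2 := Finset.le_card_sdiff B (nbin G S v)
    omega
  obtain ⟨n, hninj, hnt⟩ := (Finset.all_card_le_biUnion_card_iff_exists_injective
    (fun p : Fin h × Fin h => nbin G S (b p.1) \ B)).1 (by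
      intro s
      rcases s.eq_empty_or_nonempty with rfl | ⟨e, hes⟩
      · simp
      · have h1 : s.card ≤ h * h := by
          have := s.card_le_univ
          simpa using this
        have h2 := Finset.card_le_card
          (Finset.subset_biUnion_of_mem (fun p : Fin h × Fin h => nbin G S (b p.1) \ B) hes)
        have h3 := hdegB (b e.1) (hBS (hbB _))
        omega)
  have hn1 : ∀ p, n p ∈ S ∧ G.Adj (b p.1) (n p) ∧ n p ∉ B := by
    intro p
    have := hnt p
    rw [Finset.mem_sdiff, mem_nbin] at this
    tauto
  set X : Finset V := (Finset.univ : Finset (Fin h)).offDiag.image n with hX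
  have hXcard : X.card + h ≤ h * h := by
    have h1 := Finset.card_image_le (s := (Finset.univ : Finset (Fin h)).offDiag) (f := n)
    rw [Finset.offDiag_card, Finset.card_univ, Fintype.card_fin] at h1
    rw [hX]
    omega
  have hXm : ∀ x ∈ X, x ∈ S ∧ x ∉ B := by
    intro x hx
    obtain ⟨p, -, rfl⟩ := Finset.mem_image.1 hx
    exact ⟨(hn1 p).1, (hn1 p).2.2⟩
  have hnX : ∀ i j, i ≠ j → n (i, j) ∈ X := by
    intro i j hij
    exact Finset.mem_image.2 ⟨(i, j), by simp [hij], rfl⟩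
  clear_value X
  set U : Finset V := S \ (B ∪ X) with hU
  have hUm : ∀ v, v ∈ U ↔ v ∈ S ∧ v ∉ B ∧ v ∉ X := by
    intro v; rw [hU, Finset.mem_sdiff, Finset.mem_union, not_or]
  have hUne : 0 < U.card := by
    have h1 := Finset.le_card_sdiff (B ∪ X) S
    have h2 := Finset.card_union_le B X
    rw [← hU] at h1
    omega
  clear_value U
  set H : SimpleGraph V := mono G (S \ B) (fun _ => ()) with hH
  have hHadj : ∀ x y, H.Adj x y ↔ G.Adj x y ∧ (x ∈ S ∧ x ∉ B) ∧ (y ∈ S ∧ y ∉ B) := by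
    intro x y
    rw [hH, mono_adj, Finset.mem_sdiff, Finset.mem_sdiff]
    tauto
  clear_value H
  have hM : Massed (64 * (h * h)) H U X := by
    refine ⟨?_, ?_, ?_, ?_⟩
    · rw [Finset.disjoint_left]
      intro a ha
      exact ((hUm a).1 ha).2.2
    · intro v hv
      obtain ⟨h1, w, hw, hwv⟩ := mem_nb.1 hv
      rw [hHadj] at hwv
      rw [hUm] at h1
      tauto
    · refine lt_of_lt_of_le ?_ (sum_deg_le (G := H) (U := U))
      have h1 : U.card * (64 * (h * h) + 1) ≤ ∑ u ∈ U, (nbin H Finset.univ u).card := by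
        rw [← smul_eq_mul]
        refine Finset.card_nsmul_le_sum _ _ _ (fun u hu => ?_)
        rw [hUm] at hu
        have h2 := hdegB u hu.1
        have h3 : nbin G S u \ B ⊆ nbin H Finset.univ u := by
          intro z hz
          rw [Finset.mem_sdiff, mem_nbin] at hz
          rw [mem_nbin, hHadj]
          exact ⟨Finset.mem_univ _, hz.1.2, ⟨hu.1, hu.2.1⟩, hz.1.1, hz.2⟩
        have h4 := Finset.card_le_card h3
        omega
      refine lt_of_lt_of_le ?_ h1
      rw [mul_comm]
      exact Nat.mul_lt_mul_of_pos_left (by omega) hUne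
    · intro W hW hWc
      rcases W.eq_empty_or_nonempty with rfl | hWne
      · simp [rho, rhoSet]
      exfalso
      have hWS : W ⊆ S := fun w hw => ((hUm w).1 (hW hw)).1
      have h1 : nb G W ∩ S ⊆ nb H W ∪ B := by
        intro z hz
        rw [Finset.mem_inter, mem_nb] at hz
        obtain ⟨⟨h1, w, hw, hwz⟩, hzS⟩ := hz
        rw [Finset.mem_union]
        by_cases hzB : z ∈ B
        · exact Or.inr hzB
        · have hwU := (hUm w).1 (hW hw)
          exact Or.inl (mem_nb.2 ⟨h1, w, hw, (hHadj w z).2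
            ⟨hwz, ⟨hwU.1, hwU.2.1⟩, hzS, hzB⟩⟩)
      have h2 := (Finset.card_le_card h1).trans (Finset.card_union_le _ _)
      have h3 := hsep W hWS hWne (by omega)
      have h4 : X ⊆ nb H W := by
        intro x hx
        have hxm := hXm x hx
        rcases Finset.mem_union.1 (h3 hxm.1) with h | h
        · exact absurd hx ((hUm x).1 (hW h)).2.2
        · rcases Finset.mem_union.1 (h1 h) with h | h
          · exact h
          · exact absurd h hxm.2
      have := Finset.card_le_card h4
      omega
  have hL : Linked (Sym2 (Fin h)) H U X :=
    massed_linked (by omega : 1 ≤ h * h) _ H U X rfl (by omega) hM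
  let c : V → Sym2 (Fin h) :=
    Function.extend n (fun p => s(p.1, p.2)) (fun _ => s(⟨0, hh⟩, ⟨0, hh⟩))
  have hc : ∀ p, c (n p) = s(p.1, p.2) := fun p => hninj.extend_apply _ _ p
  obtain ⟨f, hf1, hf2⟩ := hL c
  refine ⟨b, f, hbinj, fun i j hij => ?_⟩
  obtain ⟨w⟩ := hf2 (n (i, j)) (hnX i j hij) (n (j, i)) (hnX j i hij.symm)
    (by rw [hc, hc]; exact Sym2.eq_swap)
  have hw := mono_walk w (Finset.mem_union_right _ (hnX i j hij))
  have hle : mono H (U ∪ X) f ≤ G := fun x y hxy => ((hHadj x y).1 hxy.1).1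
  have hw2 : ∀ v ∈ (w.mapLe hle).support, v ∉ Set.range b ∧ f v = s(i, j) := by
    intro v hv
    rw [SimpleGraph.Walk.support_mapLe_eq_support] at hv
    obtain ⟨h1, h2⟩ := hw v hv
    refine ⟨?_, by rw [h2, hf1 _ (hnX i j hij), hc]⟩
    rintro ⟨k, rfl⟩
    rcases Finset.mem_union.1 h1 with h | h
    · exact ((hUm _).1 h).2.1 (hbB k)
    · exact (hXm _ h).2 (hbB k)
  let w' : G.Walk (b i) (b j) := SimpleGraph.Walk.cons (hn1 (i, j)).2.1
    ((w.mapLe hle).append (SimpleGraph.Walk.cons (hn1 (j, i)).2.1.symm SimpleGraph.Walk.nil))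
  refine ⟨w'.bypass, w'.bypass_isPath, fun v hv => ?_⟩
  have hv' := w'.support_bypass_subset hv
  simp only [w', SimpleGraph.Walk.support_cons, List.mem_cons,
    SimpleGraph.Walk.mem_support_append_iff, SimpleGraph.Walk.support_nil, List.not_mem_nil,
    or_false] at hv'
  rcases hv' with h1 | h1 | h1 | h1
  · exact Or.inl h1
  · exact Or.inr (Or.inr (hw2 v h1))
  · rw [h1]; exact Or.inr (Or.inr (hw2 _ (SimpleGraph.Walk.end_mem_support _)))
  · exact Or.inr (Or.inl h1)

lemma IsSubdivision.trans' {V1 V2 V3 : Type} {A : SimpleGraph V1} {B : SimpleGraph V2}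
    {D : SimpleGraph V3} (h1 : IsSubdivision A B) (h2 : IsSubdivision B D) :
    IsSubdivision A D := by
  induction h2 with
  | refl _ => exact h1
  | step _ H a b _ hab ih => exact IsSubdivision.step _ H a b (ih h1) hab

lemma path_uncons {G : SimpleGraph V} {x y : V} (w : G.Walk x y) (hw : w.IsPath) (hxy : x ≠ y) :
    ∃ (p : V) (_ : G.Adj x p) (w' : G.Walk p y), w'.IsPath ∧ x ∉ w'.support ∧
      ∀ v ∈ w'.support, v ∈ w.support := by
  cases w with
  | nil => exact absurd rfl hxy
  | cons hadj w' =>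
    rw [SimpleGraph.Walk.cons_isPath_iff] at hw
    exact ⟨_, hadj, w', hw.1, hw.2, fun v hv => by simp [hv]⟩

/-- `w` realises the edge `ab` of the pattern. -/
def Realises {W : Type} (G : SimpleGraph V) (φ : W → V) (f : V → Sym2 W) (a b : W) : Prop :=
  ∃ w : G.Walk (φ a) (φ b), w.IsPath ∧ ∀ v ∈ w.support,
    v = φ a ∨ v = φ b ∨ (v ∉ Set.range φ ∧ f v = s(a, b))

lemma Realises.symm {W : Type} {G : SimpleGraph V} {φ : W → V} {f : V → Sym2 W} {a b : W}
    (h : Realises G φ f a b) : Realises G φ f b a := by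
  obtain ⟨w, h1, h2⟩ := h
  refine ⟨w.reverse, h1.reverse, fun v hv => ?_⟩
  rw [SimpleGraph.Walk.support_reverse, List.mem_reverse] at hv
  have := h2 v hv
  rw [Sym2.eq_swap]
  tauto

lemma subdiv_glue {G : SimpleGraph V} (n : ℕ) : ∀ (W : Type) [Fintype W] (H : SimpleGraph W)
    (φ : W → V) (f : V → Sym2 W), Fintype.card V - Fintype.card W = n → Function.Injective φ →
    (∀ a b, H.Adj a b → Realises G φ f a b) →
    ∃ (W' : Type) (S : SimpleGraph W'), IsSubdivision H S ∧ HasSubgraphCopy G S := by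
  induction n using Nat.strong_induction_on with
  | _ n IH =>
  intro W _ H φ f hn hφ hR
  by_cases hall : ∀ a b, H.Adj a b → G.Adj (φ a) (φ b)
  · exact ⟨W, H, IsSubdivision.refl H, ⟨φ, fun {a b} hab => hall a b hab⟩, hφ⟩
  push Not at hall
  obtain ⟨a, b, hab, hnab⟩ := hall
  obtain ⟨w, hw1, hw2⟩ := hR a b hab
  obtain ⟨p, hap, w', hw', haw', hsub⟩ := path_uncons w hw1 (fun h => hab.ne (hφ h))
  have hp : p ∉ Set.range φ ∧ f p = s(a, b) := by
    rcases hw2 p (hsub p w'.start_mem_support) with h | h | h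
    · exact absurd h hap.ne'
    · rw [h] at hap; exact absurd hap hnab
    · exact h
  let φ' : Option W → V := fun o => o.elim p φ
  have hφn : φ' none = p := rfl
  have hφs : ∀ x, φ' (some x) = φ x := fun _ => rfl
  have hφ' : Function.Injective φ' := by
    rintro (_ | x) (_ | y) hxy
    · rfl
    · exact absurd ⟨y, hxy.symm⟩ hp.1
    · exact absurd ⟨x, hxy⟩ hp.1
    · exact congrArg some (hφ hxy)
  let f' : V → Sym2 (Option W) := fun v =>
    if f v = s(a, b) then s(none, some b) else Sym2.map some (f v)
  have hrange : ∀ v, v ∉ Set.range φ → v ≠ p → v ∉ Set.range φ' := by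
    rintro v h1 h2 ⟨_ | x, rfl⟩
    · exact h2 rfl
    · exact h1 ⟨x, rfl⟩
  have hcard : Fintype.card (Option W) ≤ Fintype.card V := Fintype.card_le_of_injective φ' hφ'
  rw [Fintype.card_option] at hcard
  obtain ⟨W', S, hS1, hS2⟩ := IH (Fintype.card V - (Fintype.card W + 1)) (by omega) (Option W)
    (edgeSubdiv H a b) φ' f' (by rw [Fintype.card_option]) hφ' (by
      have key : ∀ x y : Option W, ((∃ x' y' : W, x = some x' ∧ y = some y' ∧ H.Adj x' y' ∧
          ¬((x' = a ∧ y' = b) ∨ (x' = b ∧ y' = a))) ∨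
          (x = none ∧ (y = some a ∨ y = some b))) → Realises G φ' f' x y := by
        rintro x y (⟨x', y', rfl, rfl, hxy, hne⟩ | ⟨rfl, rfl | rfl⟩)
        · obtain ⟨u, hu1, hu2⟩ := hR x' y' hxy
          refine ⟨u, hu1, fun v hv => ?_⟩
          rcases hu2 v hv with h | h | ⟨h1, h2⟩
          · exact Or.inl h
          · exact Or.inr (Or.inl h)
          · have hne' : f v ≠ s(a, b) := by
              rw [h2, Ne, Sym2.eq_iff]; exact hne
            refine Or.inr (Or.inr ⟨hrange v h1 ?_, ?_⟩)
            · rintro rfl; exact hne' hp.2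
            · simp only [f', if_neg hne']
              rw [h2, Sym2.map_mk]
        · have hedge : ∃ u : G.Walk p (φ a), u.IsPath ∧ ∀ v ∈ u.support, v = p ∨ v = φ a := by
            refine ⟨SimpleGraph.Walk.cons hap.symm SimpleGraph.Walk.nil, ?_, fun v hv => ?_⟩
            · rw [SimpleGraph.Walk.cons_isPath_iff]
              refine ⟨SimpleGraph.Walk.IsPath.nil, ?_⟩
              rw [SimpleGraph.Walk.support_nil, List.mem_singleton]
              exact hap.ne'
            · simpa using hv
          obtain ⟨u, hu1, hu2⟩ := hedge
          refine ⟨u, hu1, fun v hv => ?_⟩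
          rcases hu2 v hv with h | h
          · exact Or.inl h
          · exact Or.inr (Or.inl h)
        · refine ⟨w', hw', fun v hv => ?_⟩
          by_cases hvp : v = p
          · exact Or.inl hvp
          · rcases hw2 v (hsub v hv) with h | h | ⟨h1, h2⟩
            · rw [h] at hv; exact absurd hv haw'
            · exact Or.inr (Or.inl h)
            · refine Or.inr (Or.inr ⟨hrange v h1 hvp, ?_⟩)
              simp only [f', if_pos h2]
      intro x y hxy
      unfold edgeSubdiv at hxy
      rw [SimpleGraph.fromRel_adj] at hxy
      rcases hxy.2 with h | h
      · exact key x y h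
      · exact (key y x h).symm)
  exact ⟨W', S, (IsSubdivision.step H H a b (IsSubdivision.refl H) hab).trans' hS1, hS2⟩

end Aux

/-- For every positive integer `h`, every graph with average degree at
least `256h²` contains a subdivision of the complete graph `K_h` as a subgraph. -/
theorem stmt_16 (h : ℕ) (hh : 0 < h) {V : Type} [Fintype V] (G : SimpleGraph V)
    (hd : 256 * (h : ℝ) ^ 2 ≤ avgDeg G) :
    ∃ (W : Type) (S : SimpleGraph W),
      IsSubdivision (completeGraph (Fin h)) S ∧ HasSubgraphCopy G S := by
  classical
  unfold avgDeg at hd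
  have hpos : (0 : ℝ) < 256 * (h : ℝ) ^ 2 := by positivity
  have hn : 0 < Fintype.card V := by
    rcases Nat.eq_zero_or_pos (Fintype.card V) with h0 | h0
    · rw [h0] at hd
      simp at hd
      exfalso
      have : (0 : ℝ) < (h : ℝ) ^ 2 := by positivity
      nlinarith
    · exact h0
  have he : 256 * (h * h) * Fintype.card V ≤ ee G Finset.univ := by
    rw [ee_univ]
    rw [le_div_iff₀ (by exact_mod_cast hn)] at hd
    have : (256 * (h * h) * Fintype.card V : ℝ) ≤ 2 * G.edgeSet.ncard := by
      rw [← pow_two]; exact hd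
    exact_mod_cast this
  obtain ⟨b, f, hb, hw⟩ := branch_paths hh hn he
  exact subdiv_glue _ (Fin h) (completeGraph (Fin h)) b f rfl hb
    (fun i j hij => hw i j (by simpa using hij))
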